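/- arXiv:2505.24490 — 3 statements merged into one kernel-verified Lean document; each statement's English description precedes it below -/
import Mathlib

section
/- For every positive integer k such that 2k is a perfect square, and for every N, there exist an integer n ≥ N, a set V of n points in the plane in convex position, a partition of V into sets A and B, and a set E of edges on V each joining a point of A to a point of B, forming a bipartite outer k-planar graph with |E| ≥ (1/√2)·√k·n. -/
open scoped Classical

/-- A point in the plane. -/
abbrev Pt := EuclideanSpace ℝ (Fin 2)

/-- A finite point set is in convex position (convexly independent). -/
def ConvexPos (V : Finset Pt) : Prop :=
  ∀ p ∈ V, p ∉ convexHull ℝ ((V.erase p : Finset Pt) : Set Pt)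

/-- The open straight-line segment drawn for an unordered pair of points. -/
noncomputable def edgeSeg (e : Sym2 Pt) : Set Pt :=
  Sym2.lift ⟨fun a b => openSegment ℝ a b, fun a b => openSegment_symm ℝ a b⟩ e

/-- Two distinct edges cross if their open segments intersect. -/
def Cross (e f : Sym2 Pt) : Prop :=
  e ≠ f ∧ (edgeSeg e ∩ edgeSeg f).Nonempty

theorem Cross_comm (e f : Sym2 Pt) : Cross e f ↔ Cross f e := by
  unfold Cross
  rw [Set.inter_comm]
  exact and_congr_left' ne_comm

/-- A convex geometric graph: points in convex position, edges are unordered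
pairs of distinct points of `V`. -/
structure ConvexGeomGraph where
  V : Finset Pt
  E : Finset (Sym2 Pt)
  convexPos : ConvexPos V
  not_diag : ∀ e ∈ E, ¬ e.IsDiag
  mem_V : ∀ e ∈ E, ∀ p ∈ e, p ∈ V

/-- A convex geometric graph is outer `k`-planar if every edge crosses at
most `k` other edges. -/
noncomputable def OuterKPlanar (G : ConvexGeomGraph) (k : ℕ) : Prop :=
  ∀ e ∈ G.E, (G.E.filter (fun f => Cross e f)).card ≤ k

/-- Bipartite: vertices can be partitioned into `A` and `B` with every edge
joining a point of `A` to a point of `B`. -/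
def Bipartite (G : ConvexGeomGraph) : Prop :=
  ∃ A B : Finset Pt, A ∪ B = G.V ∧ Disjoint A B ∧
    ∀ e ∈ G.E, ∃ a ∈ A, ∃ b ∈ B, e = s(a, b)

/-- The degree of a vertex: number of edges containing it. -/
noncomputable def degree (G : ConvexGeomGraph) (v : Pt) : ℕ :=
  (G.E.filter (fun e => v ∈ e)).card

/-- The number of unordered pairs of distinct edges that cross. -/
noncomputable def crossingNumber (E : Finset (Sym2 Pt)) : ℕ :=
  (E.sym2.filter (fun pr => Sym2.lift
    ⟨fun e f => Cross e f, fun e f => propext (Cross_comm e f)⟩ pr)).card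

open Finset

/-- The point with abscissa `i` on the standard parabola. -/
noncomputable def parabolaPt (i : ℕ) : Pt := !₂[(i : ℝ), (i : ℝ) ^ 2]

/-- The affine function whose zero set is the line through the points of the parabola with
abscissas `a` and `b`. -/
noncomputable def secantForm (a b : ℝ) (p : Pt) : ℝ := p 1 - (a + b) * p 0 + a * b

theorem secantForm_parabolaPt (a b : ℝ) (i : ℕ) :
    secantForm a b (parabolaPt i) = ((i : ℝ) - a) * ((i : ℝ) - b) := by
  simp only [secantForm, parabolaPt, PiLp.toLp_apply, Matrix.cons_val_zero, Matrix.cons_val_one]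
  ring

theorem secantForm_combo (a b : ℝ) (p q : Pt) {u v : ℝ} (huv : u + v = 1) :
    secantForm a b (u • p + v • q) = u * secantForm a b p + v * secantForm a b q := by
  obtain rfl : v = 1 - u := by linarith
  simp only [secantForm, PiLp.add_apply, PiLp.smul_apply, smul_eq_mul]
  ring

theorem parabolaPt_injective : Function.Injective parabolaPt := by
  intro i j h
  have h0 := congrArg (fun p : Pt => p 0) h
  simpa [parabolaPt] using h0

theorem convexPos_image_parabolaPt (s : Finset ℕ) : ConvexPos (s.image parabolaPt) := by
  intro p hp hmem
  obtain ⟨c, -, rfl⟩ := Finset.mem_image.1 hp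
  have hconv : Convex ℝ {q : Pt | 0 < secantForm c c q} := by
    intro x hx y hy u v hu hv huv
    simp only [Set.mem_ofPred_eq] at hx hy ⊢
    rw [secantForm_combo _ _ _ _ huv]
    rcases hu.eq_or_lt with rfl | hu
    · obtain rfl : v = 1 := by linarith
      simpa using hy
    · have := mul_pos hu hx
      have := mul_nonneg hv hy.le
      linarith
  have hsub : (((s.image parabolaPt).erase (parabolaPt c) : Finset Pt) : Set Pt) ⊆
      {q : Pt | 0 < secantForm c c q} := by
    intro q hq
    obtain ⟨hne, hq⟩ := Finset.mem_erase.1 (Finset.mem_coe.1 hq)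
    obtain ⟨i, -, rfl⟩ := Finset.mem_image.1 hq
    have hic : (i : ℝ) - c ≠ 0 := by
      rw [sub_ne_zero]
      rintro h
      exact hne (by rw [Nat.cast_injective h])
    rw [Set.mem_ofPred_eq, secantForm_parabolaPt]
    exact mul_self_pos.2 hic
  have h := convexHull_min hsub hconv hmem
  rw [Set.mem_ofPred_eq, secantForm_parabolaPt] at h
  simp at h

/-- A chord of the parabola that crosses the chord over `[a, b]` has one end strictly between the
ends of the latter and one end strictly outside. -/
theorem interleave_of_cross {a b c d : ℕ} (hab : a < b) (hcd : c ≠ d)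
    (h : Cross s(parabolaPt c, parabolaPt d) s(parabolaPt a, parabolaPt b)) :
    (a < c ∧ c < b ∧ (d < a ∨ b < d)) ∨ (a < d ∧ d < b ∧ (c < a ∨ b < c)) := by
  obtain ⟨hne, q, hq, hq'⟩ := h
  obtain ⟨u, v, hu, hv, huv, rfl⟩ : q ∈ openSegment ℝ (parabolaPt c) (parabolaPt d) := hq
  obtain ⟨u', v', -, -, huv', heq⟩ : _ ∈ openSegment ℝ (parabolaPt a) (parabolaPt b) := hq'
  have key := congrArg (secantForm a b) heq
  rw [secantForm_combo _ _ _ _ huv, secantForm_combo _ _ _ _ huv'] at key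
  simp only [secantForm_parabolaPt, sub_self, mul_zero, zero_mul, add_zero] at key
  have hneg : ∀ i : ℕ, ((i : ℝ) - a) * ((i : ℝ) - b) < 0 ↔ a < i ∧ i < b := by
    intro i
    have hab' : (a : ℝ) < b := by exact_mod_cast hab
    rw [← Nat.cast_lt (α := ℝ), ← Nat.cast_lt (α := ℝ), mul_neg_iff]
    constructor
    · rintro (h | h) <;> constructor <;> linarith
    · rintro h
      left
      constructor <;> linarith
  have hzero : ∀ i : ℕ, ((i : ℝ) - a) * ((i : ℝ) - b) = 0 ↔ i = a ∨ i = b := by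
    intro i
    rw [mul_eq_zero, sub_eq_zero, sub_eq_zero, Nat.cast_inj, Nat.cast_inj]
  have hc := hneg c
  have hd := hneg d
  have hc0 := hzero c
  have hd0 := hzero d
  have hends : ¬ ((c = a ∨ c = b) ∧ (d = a ∨ d = b)) := by
    rintro ⟨rfl | rfl, rfl | rfl⟩
    · exact hcd rfl
    · exact hne rfl
    · exact hne Sym2.eq_swap
    · exact hcd rfl
  generalize ((c : ℝ) - a) * ((c : ℝ) - b) = x at *
  generalize ((d : ℝ) - a) * ((d : ℝ) - b) = y at *
  rcases lt_trichotomy x 0 with hx | hx | hx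
  · have hy : 0 < y := by
      by_contra! hy
      nlinarith [mul_pos_of_neg_of_neg hx (neg_lt_zero.2 hu)]
    have h1 := hc.1 hx
    have h2 := mt hd.2 hy.not_gt
    have h3 := mt hd0.2 hy.ne'
    omega
  · have hy : y = 0 := by
      rw [hx, mul_zero, zero_add] at key
      exact (mul_eq_zero.1 key.symm).resolve_left hv.ne'
    exact absurd ⟨hc0.1 hx, hd0.1 hy⟩ hends
  · have hy : y < 0 := by
      by_contra! hy
      nlinarith [mul_pos hu hx, mul_nonneg hv.le hy]
    have h1 := hd.1 hy
    have h2 := mt hc.2 hx.not_gt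
    have h3 := mt hc0.2 hx.ne'
    omega

/-- Addition of a step `l ≤ n` to a residue `x < n` modulo `n`. -/
def cyclicAdd (n x l : ℕ) : ℕ := if x + l < n then x + l else x + l - n

/-- The chord of the parabola that joins `x` to its `(2 * s + 1)`-st cyclic successor. -/
noncomputable def oddChord (n : ℕ) (p : ℕ × ℕ) : Sym2 Pt :=
  s(parabolaPt p.1, parabolaPt (cyclicAdd n p.1 (2 * p.2 + 1)))

/-- All chords of odd cyclic length less than `2 * t` on `n` points. -/
noncomputable def oddChords (n t : ℕ) : Finset (Sym2 Pt) :=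
  (range n ×ˢ range t).image (oddChord n)

/-- The chords of odd cyclic length less than `2 * t` whose arc covers the point `p`. -/
noncomputable def coveringChords (n t p : ℕ) : Finset (Sym2 Pt) :=
  ((range t).sigma fun s => range (2 * s + 1)).image
    fun q => oddChord n (cyclicAdd n p (n - 1 - q.2), q.1)

theorem card_coveringChords_le (n t p : ℕ) : (coveringChords n t p).card ≤ t ^ 2 := by
  refine card_image_le.trans ?_
  rw [card_sigma]
  simp only [card_range]
  induction t with
  | zero => simp
  | succ t ih =>
    rw [sum_range_succ]
    nlinarith

theorem card_oddChords {n t : ℕ} (hn : 4 * t ≤ n) : (oddChords n t).card = n * t := by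
  rw [oddChords, card_image_of_injOn, card_product, card_range, card_range]
  rintro ⟨x, s⟩ hx ⟨y, r⟩ hy h
  simp only [coe_product, Set.mem_prod, mem_coe, mem_range] at hx hy
  simp only [oddChord, Sym2.eq_iff, parabolaPt_injective.eq_iff, cyclicAdd] at h
  rw [Prod.mk.injEq]
  split_ifs at h <;> omega

theorem oddChord_mem_coveringChords {n t x s p : ℕ} (hx : x < n) (hs : s < t)
    (hp : p < n) (h : x < p ∧ p ≤ x + 2 * s + 1 ∨ p + n ≤ x + 2 * s + 1) :
    oddChord n (x, s) ∈ coveringChords n t p := by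
  rw [coveringChords, mem_image]
  refine ⟨⟨s, if x < p then p - x - 1 else p + n - x - 1⟩, ?_, ?_⟩
  · simp only [mem_sigma, mem_range]
    refine ⟨hs, ?_⟩
    split_ifs <;> omega
  · congr 2
    simp only [cyclicAdd]
    split_ifs <;> omega

theorem card_filter_cross_oddChords_le {n t : ℕ} (hn : 4 * t ≤ n) {e : Sym2 Pt}
    (he : e ∈ oddChords n t) :
    ((oddChords n t).filter (fun f => Cross e f)).card ≤ 2 * t ^ 2 := by
  obtain ⟨⟨c, r⟩, hcr, rfl⟩ := mem_image.1 he
  obtain ⟨hc, hr⟩ := mem_product.1 hcr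
  simp only [mem_range] at hc hr
  have hsub : (oddChords n t).filter (fun f => Cross (oddChord n (c, r)) f) ⊆
      coveringChords n t c ∪ coveringChords n t (cyclicAdd n c (2 * r + 1)) := by
    intro f hf
    obtain ⟨hf, hcross⟩ := mem_filter.1 hf
    obtain ⟨⟨x, s⟩, hxs, rfl⟩ := mem_image.1 hf
    obtain ⟨hx, hs⟩ := mem_product.1 hxs
    simp only [mem_range] at hx hs
    simp only [oddChord] at hcross
    have hd : cyclicAdd n c (2 * r + 1) < n ∧ c ≠ cyclicAdd n c (2 * r + 1) := by
      simp only [cyclicAdd]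
      split_ifs <;> omega
    generalize cyclicAdd n c (2 * r + 1) = d at *
    have hcov : (x < c ∧ c ≤ x + 2 * s + 1 ∨ c + n ≤ x + 2 * s + 1) ∨
        (x < d ∧ d ≤ x + 2 * s + 1 ∨ d + n ≤ x + 2 * s + 1) := by
      by_cases hlt : x + (2 * s + 1) < n
      · rw [cyclicAdd, if_pos hlt] at hcross
        have := interleave_of_cross (by omega) hd.2 hcross
        omega
      · rw [cyclicAdd, if_neg hlt, Sym2.eq_swap (a := parabolaPt x)] at hcross
        have := interleave_of_cross (by omega) hd.2 hcross
        omega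
    rw [mem_union]
    exact hcov.imp (oddChord_mem_coveringChords hx hs hc)
      (oddChord_mem_coveringChords hx hs hd.1)
  refine (card_le_card hsub).trans ((card_union_le _ _).trans ?_)
  have h1 := card_coveringChords_le n t c
  have h2 := card_coveringChords_le n t (cyclicAdd n c (2 * r + 1))
  omega

/-- The convex geometric graph on `n` points of the parabola formed by all chords of odd cyclic
length less than `2 * t`. -/
noncomputable def oddChordGraph (n t : ℕ) (hn : 4 * t ≤ n) : ConvexGeomGraph where
  V := (range n).image parabolaPt
  E := oddChords n t
  convexPos := convexPos_image_parabolaPt _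
  not_diag := by
    intro e he
    obtain ⟨⟨x, s⟩, hxs, rfl⟩ := mem_image.1 he
    simp only [mem_product, mem_range] at hxs
    simp only [oddChord, Sym2.mk_isDiag_iff, parabolaPt_injective.eq_iff, cyclicAdd]
    split_ifs <;> omega
  mem_V := by
    intro e he p hp
    obtain ⟨⟨x, s⟩, hxs, rfl⟩ := mem_image.1 he
    simp only [mem_product, mem_range] at hxs
    rcases Sym2.mem_iff.1 hp with rfl | rfl
    · exact mem_image_of_mem _ (mem_range.2 hxs.1)
    · refine mem_image_of_mem _ (mem_range.2 ?_)
      simp only [cyclicAdd]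
      split_ifs <;> omega

theorem bipartite_oddChordGraph {n t : ℕ} (hn : 4 * t ≤ n) (heven : Even n) :
    Bipartite (oddChordGraph n t hn) := by
  refine ⟨((range n).filter Even).image parabolaPt,
    ((range n).filter fun i => ¬ Even i).image parabolaPt, ?_, ?_, ?_⟩
  · rw [← image_union, filter_union_filter_not_eq]
    rfl
  · rw [disjoint_image parabolaPt_injective]
    exact disjoint_filter_filter_not _ _ _
  · intro e he
    obtain ⟨⟨x, s⟩, hxs, rfl⟩ := mem_image.1 he
    simp only [mem_product, mem_range] at hxs
    have hy : cyclicAdd n x (2 * s + 1) < n ∧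
        (Even (cyclicAdd n x (2 * s + 1)) ↔ ¬ Even x) := by
      simp only [Nat.even_iff, cyclicAdd] at heven ⊢
      split_ifs <;> omega
    simp only [oddChord]
    by_cases hx : Even x
    · exact ⟨_, mem_image_of_mem _ (mem_filter.2 ⟨mem_range.2 hxs.1, hx⟩),
        _, mem_image_of_mem _ (mem_filter.2 ⟨mem_range.2 hy.1, fun h => hy.2.1 h hx⟩), rfl⟩
    · exact ⟨_, mem_image_of_mem _ (mem_filter.2 ⟨mem_range.2 hy.1, hy.2.2 hx⟩),
        _, mem_image_of_mem _ (mem_filter.2 ⟨mem_range.2 hxs.1, hx⟩), Sym2.eq_swap⟩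

/-- for every positive k with 2k a perfect square and every N,
there is a bipartite outer k-planar graph on n ≥ N vertices with at least
(1/√2)·√k·n edges. -/
theorem stmt12 (k : ℕ) (hk : 0 < k) (hsq : ∃ m : ℕ, m ^ 2 = 2 * k) (N : ℕ) :
    ∃ n ≥ N, ∃ G : ConvexGeomGraph, G.V.card = n ∧ OuterKPlanar G k ∧
      Bipartite G ∧ (1 / Real.sqrt 2) * Real.sqrt k * n ≤ (G.E.card : ℝ) := by
  obtain ⟨m, hm⟩ := hsq
  obtain ⟨t, rfl⟩ : 2 ∣ m := Nat.prime_two.dvd_of_dvd_pow ⟨k, hm⟩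
  obtain rfl : k = 2 * t ^ 2 := by
    rw [mul_pow] at hm
    omega
  have hn : 4 * t ≤ 2 * (N + 2 * t) := by omega
  refine ⟨2 * (N + 2 * t), by omega, oddChordGraph _ t hn, ?_,
    fun e he => card_filter_cross_oddChords_le hn he,
    bipartite_oddChordGraph hn (even_two_mul _), ?_⟩
  · simp only [oddChordGraph]
    rw [card_image_of_injective _ parabolaPt_injective, card_range]
  · have hE : (oddChordGraph _ t hn).E.card = 2 * (N + 2 * t) * t := card_oddChords hn
    have hsqrt : 1 / Real.sqrt 2 * Real.sqrt ((2 * t ^ 2 : ℕ) : ℝ) = t := by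
      push_cast
      rw [Real.sqrt_mul zero_le_two, Real.sqrt_sq (Nat.cast_nonneg t)]
      field_simp
    rw [hE, hsqrt]
    push_cast
    linarith
end

section
/- For every integer k ≥ 5, every bipartite outer k-planar graph on n vertices has at most 2.228·√k·n edges. -/
open scoped Classical

/-- The laws of a strict cyclic order, relativised to the elements of `V`. -/
structure IsCyclicOn {α : Type*} (V : Finset α) (O : α → α → α → Prop) : Prop where
  cyc : ∀ {a b c}, O a b c → O b c a
  asymm : ∀ {a b c}, O a b c → ¬ O b a c
  total : ∀ {a b c}, a ∈ V → b ∈ V → c ∈ V → a ≠ b → b ≠ c → a ≠ c → O a b c ∨ O b a c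
  trans : ∀ {a b c d}, a ∈ V → b ∈ V → c ∈ V → d ∈ V → O a b c → O a c d → O a b d

/-- The elements of `V` following `b` and preceding `a` in the cyclic order. -/
noncomputable def side {α : Type*} (V : Finset α) (O : α → α → α → Prop) (a b : α) : Finset α :=
  V.filter (O a b)

namespace IsCyclicOn

variable {α : Type*} {V : Finset α} {O : α → α → α → Prop}

theorem ne_left (h : IsCyclicOn V O) {a b c : α} (hO : O a b c) : a ≠ b := by
  rintro rfl
  exact h.asymm hO hO

theorem not_mem_side_left (h : IsCyclicOn V O) (a b : α) : a ∉ side V O a b := by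
  intro ha
  exact h.ne_left (h.cyc (h.cyc (Finset.mem_filter.1 ha).2)) rfl

theorem not_mem_side_right (h : IsCyclicOn V O) (a b : α) : b ∉ side V O a b := by
  intro ha
  exact h.ne_left (h.cyc (Finset.mem_filter.1 ha).2) rfl

theorem disjoint_side (h : IsCyclicOn V O) (a b : α) : Disjoint (side V O a b) (side V O b a) := by
  refine Finset.disjoint_left.2 fun x hx hy => ?_
  exact h.asymm (Finset.mem_filter.1 hx).2 (Finset.mem_filter.1 hy).2

theorem reverse (h : IsCyclicOn V O) : IsCyclicOn V fun a b c => O b a c where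
  cyc hO := h.cyc (h.cyc hO)
  asymm hO := h.asymm hO
  total ha hb hc hab hbc hac := (h.total ha hb hc hab hbc hac).symm
  trans ha hb hc hd h₁ h₂ :=
    h.cyc (h.cyc (h.trans ha hd hc hb (h.cyc h₂) (h.cyc h₁)))

theorem card_side_lt (h : IsCyclicOn V O) {v w x : α} (hv : v ∈ V) (hw : w ∈ V) (hx : x ∈ V)
    (hO : O v w x) : (side V O v x).card < (side V O v w).card := by
  refine Finset.card_lt_card ((Finset.ssubset_iff_of_subset ?_).2
    ⟨x, Finset.mem_filter.2 ⟨hx, hO⟩, h.not_mem_side_right v x⟩)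
  intro y hy
  obtain ⟨hyV, hy⟩ := Finset.mem_filter.1 hy
  exact Finset.mem_filter.2 ⟨hyV, h.trans hv hw hx hyV hO hy⟩

/-- At most `u` elements `w` have fewer than `u` elements between `w` and `v`. -/
theorem card_le_of_card_side_lt (h : IsCyclicOn V O) {v : α} (hv : v ∈ V) {W : Finset α}
    (hW : ∀ w ∈ W, w ∈ V ∧ w ≠ v) {u : ℕ} (hu : ∀ w ∈ W, (side V O v w).card < u) :
    W.card ≤ u := by
  have : W.card ≤ (Finset.range u).card := by
    refine Finset.card_le_card_of_injOn (fun w => (side V O v w).card)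
      (fun w hw => by simpa using hu w hw) ?_
    intro w hw x hx hwx
    by_contra hne
    have hw' := hW w hw
    have hx' := hW x hx
    rcases h.total hv hw'.1 hx'.1 hw'.2.symm hne hx'.2.symm with hO | hO
    · exact (h.card_side_lt hv hw'.1 hx'.1 hO).ne hwx.symm
    · exact (h.card_side_lt hv hx'.1 hw'.1 (h.cyc hO)).ne hwx
  simpa using this

/-- At most `2 * u` elements cut off fewer than `u` elements together with `v`. -/
theorem card_le_two_mul (h : IsCyclicOn V O) {v : α} (hv : v ∈ V) {W : Finset α}
    (hW : ∀ w ∈ W, w ∈ V ∧ w ≠ v) {u : ℕ}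
    (hu : ∀ w ∈ W, (side V O v w).card < u ∨ (side V O w v).card < u) :
    W.card ≤ 2 * u := by
  have h₁ : (W.filter fun w => (side V O v w).card < u).card ≤ u :=
    h.card_le_of_card_side_lt hv (fun w hw => hW w (Finset.mem_filter.1 hw).1)
      fun w hw => (Finset.mem_filter.1 hw).2
  have h₂ : (W.filter fun w => (side V O w v).card < u).card ≤ u :=
    h.reverse.card_le_of_card_side_lt hv (fun w hw => hW w (Finset.mem_filter.1 hw).1)
      fun w hw => (Finset.mem_filter.1 hw).2
  have h₃ : W ⊆ (W.filter fun w => (side V O v w).card < u) ∪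
      W.filter fun w => (side V O w v).card < u := by
    intro w hw
    rcases hu w hw with h' | h' <;> simp [hw, h']
  have := (Finset.card_le_card h₃).trans (Finset.card_union_le _ _)
  omega

theorem side_subset_or (h : IsCyclicOn V O) {a b v w : α} (ha : a ∈ V) (hb : b ∈ V)
    (hw : w ∈ V) (hv : v ∈ side V O a b) (hvw : v ≠ w) (hw' : w ∉ side V O b a) :
    side V O v w ⊆ side V O a b ∨ side V O w v ⊆ side V O a b := by
  obtain ⟨hvV, hv⟩ := Finset.mem_filter.1 hv
  have hab := h.ne_left hv
  have between : ∀ {p q}, p ∈ V → q ∈ V → (p = b ∨ O a b p) → O a p q →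
      side V O q p ⊆ side V O a b := by
    intro p q hp hq hbp hpq x hx
    obtain ⟨hxV, hx⟩ := Finset.mem_filter.1 hx
    have hapx := h.cyc (h.cyc (h.trans hp hxV hq ha (h.cyc hx) (h.cyc hpq)))
    refine Finset.mem_filter.2 ⟨hxV, ?_⟩
    rcases hbp with rfl | hbp
    · exact hapx
    · exact h.trans ha hb hp hxV hbp hapx
  by_cases hwa : w = a
  · subst hwa
    right
    intro x hx
    obtain ⟨hxV, hx⟩ := Finset.mem_filter.1 hx
    exact Finset.mem_filter.2 ⟨hxV, h.trans ha hb hvV hxV hv hx⟩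
  have hbw : w = b ∨ O a b w := by
    by_cases hwb : w = b
    · exact Or.inl hwb
    · refine Or.inr ((h.total ha hb hw hab (Ne.symm hwb) (Ne.symm hwa)).resolve_right ?_)
      exact fun hO => hw' (Finset.mem_filter.2 ⟨hw, hO⟩)
  have hav : a ≠ v := by
    rintro rfl
    exact h.ne_left (h.cyc (h.cyc hv)) rfl
  rcases h.total ha hvV hw hav hvw (Ne.symm hwa) with hO | hO
  · exact Or.inr (between hvV hw (Or.inr hv) hO)
  · exact Or.inl (between hw hvV hbw (h.cyc hO))

end IsCyclicOn

theorem lt_mul_of_sq {k δ : ℕ} (hδ : 5 ≤ δ) (hk : 4963984 * k < 1000000 * δ ^ 2) :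
    ∃ u, 2 * u < δ ∧ 2 * k < u * (2 * δ - 2 - u) ∧ k < (2 * δ - 1 - u) * (δ - 2 * u) := by
  refine ⟨(δ + 2) / 3, by omega, ?_⟩
  obtain ⟨q, hq⟩ : ∃ q, δ = 3 * q + 5 ∨ δ = 3 * q + 6 ∨ δ = 3 * q + 7 := ⟨(δ - 5) / 3, by omega⟩
  rcases hq with rfl | rfl | rfl
  · have h₁ : (3 * q + 5 + 2) / 3 = q + 2 := by omega
    have h₂ : 2 * (3 * q + 5) - 2 - (q + 2) = 5 * q + 6 := by omega
    have h₃ : 2 * (3 * q + 5) - 1 - (q + 2) = 5 * q + 7 := by omega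
    have h₄ : 3 * q + 5 - 2 * (q + 2) = q + 1 := by omega
    rw [h₁, h₂, h₃, h₄]
    constructor <;> nlinarith
  · have h₁ : (3 * q + 6 + 2) / 3 = q + 2 := by omega
    have h₂ : 2 * (3 * q + 6) - 2 - (q + 2) = 5 * q + 8 := by omega
    have h₃ : 2 * (3 * q + 6) - 1 - (q + 2) = 5 * q + 9 := by omega
    have h₄ : 3 * q + 6 - 2 * (q + 2) = q + 2 := by omega
    rw [h₁, h₂, h₃, h₄]
    constructor <;> nlinarith
  · have h₁ : (3 * q + 7 + 2) / 3 = q + 3 := by omega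
    have h₂ : 2 * (3 * q + 7) - 2 - (q + 3) = 5 * q + 9 := by omega
    have h₃ : 2 * (3 * q + 7) - 1 - (q + 3) = 5 * q + 10 := by omega
    have h₄ : 3 * q + 7 - 2 * (q + 3) = q + 1 := by omega
    rw [h₁, h₂, h₃, h₄]
    constructor
    · nlinarith
    · rcases Nat.eq_zero_or_pos q with rfl | hq
      · omega
      · nlinarith

/-- In a bipartite graph on `p` vertices the degree sum is at most `p ^ 2 / 2`. -/
theorem two_mul_sum_card_filter_le {α : Type*} (S : Finset α) (adj : α → α → Prop) (A : Set α)
    (hA : ∀ v w, adj v w → (v ∈ A ↔ w ∉ A)) :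
    2 * ∑ v ∈ S, (S.filter (adj v)).card ≤ S.card ^ 2 := by
  have hsum := Finset.sum_filter_add_sum_filter_not S (· ∈ A) fun v => (S.filter (adj v)).card
  have hcard := Finset.card_filter_add_card_filter_not (s := S) (· ∈ A)
  have h₁ : ∑ v ∈ S with v ∈ A, (S.filter (adj v)).card ≤
      (S.filter (· ∈ A)).card * (S.filter (· ∉ A)).card := by
    rw [← smul_eq_mul]
    refine Finset.sum_le_card_nsmul _ _ _ fun v hv => Finset.card_le_card fun w hw => ?_
    rw [Finset.mem_filter] at hv hw ⊢
    exact ⟨hw.1, (hA v w hw.2).1 hv.2⟩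
  have h₂ : ∑ v ∈ S with v ∉ A, (S.filter (adj v)).card ≤
      (S.filter (· ∉ A)).card * (S.filter (· ∈ A)).card := by
    rw [← smul_eq_mul]
    refine Finset.sum_le_card_nsmul _ _ _ fun v hv => Finset.card_le_card fun w hw => ?_
    rw [Finset.mem_filter] at hv hw ⊢
    exact ⟨hw.1, by_contra fun h => hv.2 ((hA v w hw.2).2 h)⟩
  rw [← hsum, ← hcard]
  nlinarith [sq_nonneg (((S.filter (· ∈ A)).card : ℤ) - (S.filter (· ∉ A)).card),
    two_mul_le_add_sq (S.filter (· ∈ A)).card (S.filter (· ∉ A)).card]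

namespace IsCyclicOn

variable {α : Type*} {V : Finset α} {O : α → α → α → Prop}

/-- Counting the edges leaving a side of the chord `ab`. -/
theorem card_side_mul_le {adj : α → α → Prop} {k δ : ℕ} {a b : α}
    (hk : ((side V O a b ×ˢ side V O b a).filter fun p => adj p.1 p.2).card ≤ k)
    (hδ : ∀ v ∈ V, δ ≤ (V.filter (adj v)).card) :
    (side V O a b).card * δ ≤
      ∑ v ∈ side V O a b, ((V \ side V O b a).filter (adj v)).card + k := by
  have h₁ : ((side V O a b ×ˢ side V O b a).filter fun p => adj p.1 p.2).card =
      ∑ v ∈ side V O a b, ((side V O b a).filter (adj v)).card := by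
    rw [Finset.card_filter, Finset.sum_product]
    simp only [Finset.card_filter]
  rw [h₁] at hk
  refine le_trans ?_ (Nat.add_le_add_left hk _)
  rw [← Finset.sum_add_distrib, ← smul_eq_mul]
  refine Finset.card_nsmul_le_sum _ _ _ fun v hv => ?_
  refine (hδ v (Finset.mem_filter.1 hv).1).trans ?_
  refine (Finset.card_le_card ?_).trans (Finset.card_union_le _ _)
  intro w hw
  rw [Finset.mem_filter] at hw
  by_cases h : w ∈ side V O b a <;> simp [h, hw]

/-- A bipartite graph on a cyclically ordered set in which each edge crosses at most `k` others
has a vertex of small degree. -/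
theorem exists_card_adj_lt (h : IsCyclicOn V O) (hV : V.Nonempty) {adj : α → α → Prop}
    (hsymm : ∀ {v w}, adj v w → adj w v) (A : Set α) (hA : ∀ v w, adj v w → (v ∈ A ↔ w ∉ A)) {k δ : ℕ}
    (hk : ∀ a ∈ V, ∀ b ∈ V, adj a b →
      ((side V O a b ×ˢ side V O b a).filter fun p => adj p.1 p.2).card ≤ k)
    (hδ : 5 ≤ δ) (hkδ : 4963984 * k < 1000000 * δ ^ 2) :
    ∃ v ∈ V, (V.filter (adj v)).card < δ := by
  by_contra! hdeg
  obtain ⟨u, huδ, hu₁, hu₂⟩ := lt_mul_of_sq hδ hkδ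
  have hne : ∀ {v w}, adj v w → v ≠ w := by
    rintro v _ hvw rfl
    have := hA v v hvw
    tauto
  have hquad : ∀ a ∈ V, ∀ b ∈ V, adj a b → 2 * ((side V O a b).card * δ) ≤
      (side V O a b).card ^ 2 + 2 * (side V O a b).card + 2 * k := by
    intro a ha b hb hab
    have h₁ := card_side_mul_le (hk a ha b hb hab) hdeg
    have h₂ := two_mul_sum_card_filter_le (side V O a b) adj A hA
    have h₃ : ∑ v ∈ side V O a b, ((V \ side V O b a).filter (adj v)).card ≤
        ∑ v ∈ side V O a b, (((side V O a b).filter (adj v)).card + 1) := by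
      refine Finset.sum_le_sum fun v _ => ?_
      have hsub : (V \ side V O b a).filter (adj v) ⊆
          (side V O a b).filter (adj v) ∪ ({a, b} : Finset α).filter (adj v) := by
        intro w hw
        rw [Finset.mem_filter, Finset.mem_sdiff] at hw
        rw [Finset.mem_union, Finset.mem_filter, Finset.mem_filter]
        by_cases hwab : w = a ∨ w = b
        · exact Or.inr ⟨by simpa using hwab, hw.2⟩
        · push Not at hwab
          refine Or.inl ⟨Finset.mem_filter.2 ⟨hw.1.1, ?_⟩, hw.2⟩
          exact (h.total ha hb hw.1.1 (hne hab) hwab.2.symm hwab.1.symm).resolve_right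
            fun hO => hw.1.2 (Finset.mem_filter.2 ⟨hw.1.1, hO⟩)
      have hone : (({a, b} : Finset α).filter (adj v)).card ≤ 1 := by
        refine Finset.card_le_one.2 fun x hx y hy => ?_
        simp only [Finset.mem_filter, Finset.mem_insert, Finset.mem_singleton] at hx hy
        have h₁ := hA v x hx.2
        have h₂ := hA v y hy.2
        have h₃ := hA a b hab
        rcases hx.1 with rfl | rfl <;> rcases hy.1 with rfl | rfl <;> first | rfl | tauto
      exact (Finset.card_le_card hsub).trans
        ((Finset.card_union_le _ _).trans (Nat.add_le_add_left hone _))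
    rw [Finset.sum_add_distrib, Finset.sum_const, smul_eq_mul, mul_one] at h₃
    omega
  have hlong : ∃ p ∈ V ×ˢ V, adj p.1 p.2 ∧ u ≤ (side V O p.1 p.2).card ∧
      u ≤ (side V O p.2 p.1).card := by
    obtain ⟨v, hv⟩ := hV
    by_contra! hcon
    have := h.card_le_two_mul hv (W := V.filter (adj v)) (u := u)
      (fun w hw => ⟨(Finset.mem_filter.1 hw).1, (hne (Finset.mem_filter.1 hw).2).symm⟩)
      (fun w hw => by
        have := hcon (v, w) (Finset.mk_mem_product hv (Finset.mem_filter.1 hw).1)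
          (Finset.mem_filter.1 hw).2
        dsimp only at this
        omega)
    have := hdeg v hv
    omega
  obtain ⟨⟨a, b⟩, hab, hmin⟩ := Finset.exists_min_image
    ((V ×ˢ V).filter fun p => adj p.1 p.2 ∧ u ≤ (side V O p.1 p.2).card ∧
      u ≤ (side V O p.2 p.1).card) (fun p => (side V O p.1 p.2).card) (by
        obtain ⟨p, hp⟩ := hlong
        exact ⟨p, Finset.mem_filter.2 hp⟩)
  simp only [Finset.mem_filter, Finset.mem_product, Prod.forall] at hab hmin
  obtain ⟨⟨ha, hb⟩, hadj, hlab, hlba⟩ := hab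
  have hbig : 2 * δ - 1 - u ≤ (side V O a b).card := by
    have := hquad a ha b hb hadj
    by_contra! hlt
    obtain ⟨i, hi⟩ : ∃ i, (side V O a b).card = u + i := Nat.exists_eq_add_of_le hlab
    obtain ⟨j, hj⟩ : ∃ j, 2 * δ - 2 - u = u + i + j := Nat.exists_eq_add_of_le (by omega)
    have hd : 2 * δ = 2 * u + i + j + 2 := by omega
    rw [hj] at hu₁
    rw [hi] at this
    nlinarith [mul_nonneg i.zero_le j.zero_le]
  have hshort : ∀ v ∈ side V O a b, ((V \ side V O b a).filter (adj v)).card ≤ 2 * u := by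
    intro v hv
    have hvV := (Finset.mem_filter.1 hv).1
    refine h.card_le_two_mul hvV (fun w hw => ?_) fun w hw => ?_
    · rw [Finset.mem_filter, Finset.mem_sdiff] at hw
      exact ⟨hw.1.1, (hne hw.2).symm⟩
    · rw [Finset.mem_filter, Finset.mem_sdiff] at hw
      by_contra! hcon
      have hwv : adj w v := hsymm hw.2
      rcases h.side_subset_or ha hb hw.1.1 hv (hne hw.2) hw.1.2 with hs | hs
      · have := hmin v w ⟨⟨hvV, hw.1.1⟩, hw.2, hcon⟩
        have := Finset.card_lt_card ((Finset.ssubset_iff_of_subset hs).2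
          ⟨v, hv, h.not_mem_side_left v w⟩)
        omega
      · have := hmin w v ⟨⟨hw.1.1, hvV⟩, hwv, hcon.symm⟩
        have := Finset.card_lt_card ((Finset.ssubset_iff_of_subset hs).2
          ⟨v, hv, h.not_mem_side_right w v⟩)
        omega
  have h₁ := card_side_mul_le (hk a ha b hb hadj) hdeg
  have h₂ := Finset.sum_le_card_nsmul _ _ _ hshort
  rw [smul_eq_mul] at h₂
  have h₃ := Nat.mul_le_mul_right (δ - 2 * u) hbig
  have h₄ : (side V O a b).card * δ =
      (side V O a b).card * (2 * u) + (side V O a b).card * (δ - 2 * u) := by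
    rw [← mul_add, Nat.add_sub_of_le huδ.le]
  omega

end IsCyclicOn

/-- Twice the signed area of the triangle `abc`. -/
def orient (a b c : Pt) : ℝ :=
  (b 0 - a 0) * (c 1 - a 1) - (b 1 - a 1) * (c 0 - a 0)

theorem ConvexPos.mono {V W : Finset Pt} (hV : ConvexPos V) (hW : W ⊆ V) : ConvexPos W :=
  fun p hp h => hV p (hW hp)
    (convexHull_mono (Finset.coe_subset.2 (Finset.erase_subset_erase p hW)) h)

theorem ConvexPos.not_weighted_sum {V : Finset Pt} (hV : ConvexPos V) {p q r s : Pt} (hp : p ∈ V)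
    (hq : q ∈ V) (hr : r ∈ V) (hs : s ∈ V) (hqp : q ≠ p) (hrp : r ≠ p) (hsp : s ≠ p) {x y z : ℝ}
    (hx : 0 ≤ x) (hy : 0 ≤ y) (hz : 0 ≤ z) (hpos : 0 < x + y + z)
    (h : ∀ i, (x + y + z) * p i = x * q i + y * r i + z * s i) : False := by
  refine hV p hp ?_
  have hmem : ∀ {t}, t ∈ V → t ≠ p → t ∈ convexHull ℝ ((V.erase p : Finset Pt) : Set Pt) :=
    fun ht htp => subset_convexHull ℝ _ (by simp [ht, htp])
  have hc := (convex_convexHull ℝ ((V.erase p : Finset Pt) : Set Pt)).sum_mem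
    (t := Finset.univ) (w := ![x / (x + y + z), y / (x + y + z), z / (x + y + z)])
    (z := ![q, r, s])
    (by intro i _; fin_cases i <;> simp <;> positivity)
    (by simp only [Fin.sum_univ_three, Matrix.cons_val]; field_simp)
    (by intro i _; fin_cases i; exacts [hmem hq hqp, hmem hr hrp, hmem hs hsp])
  convert hc using 1
  ext i
  simp only [Fin.sum_univ_three, Matrix.cons_val, PiLp.add_apply, PiLp.smul_apply, smul_eq_mul]
  field_simp
  linarith [h i]

theorem orient_rotate (a b c : Pt) : orient b c a = orient a b c := by
  unfold orient
  ring

theorem orient_swap (a b c : Pt) : orient b a c = -orient a b c := by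
  unfold orient
  ring

theorem ne_of_orient_pos {a b c : Pt} (h : 0 < orient a b c) : a ≠ b ∧ b ≠ c ∧ a ≠ c := by
  refine ⟨?_, ?_, ?_⟩ <;> rintro rfl <;> unfold orient at h <;> linarith

theorem ConvexPos.orient_ne_zero {V : Finset Pt} (hV : ConvexPos V) {a b c : Pt} (ha : a ∈ V)
    (hb : b ∈ V) (hc : c ∈ V) (hab : a ≠ b) (hbc : b ≠ c) (hac : a ≠ c) : orient a b c ≠ 0 := by
  intro h
  obtain ⟨t, ht⟩ : ∃ t : ℝ, ∀ i, c i = (1 - t) * a i + t * b i := by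
    unfold orient at h
    by_cases h₀ : b 0 - a 0 = 0
    · have h₁ : b 1 - a 1 ≠ 0 := by
        intro h₁
        refine hab (PiLp.ext fun i => ?_)
        fin_cases i
        · exact (sub_eq_zero.1 h₀).symm
        · exact (sub_eq_zero.1 h₁).symm
      refine ⟨(c 1 - a 1) / (b 1 - a 1), fun i => ?_⟩
      fin_cases i <;> simp only [Fin.zero_eta, Fin.mk_one] <;> field_simp <;> linarith
    · refine ⟨(c 0 - a 0) / (b 0 - a 0), fun i => ?_⟩
      fin_cases i <;> simp only [Fin.zero_eta, Fin.mk_one] <;> field_simp <;> linarith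
  rcases lt_or_ge t 0 with h₀ | h₀
  · exact hV.not_weighted_sum ha hb hc hc hab.symm hac.symm hac.symm (x := -t) (y := 1) (z := 0)
      (by linarith) (by simp) le_rfl (by linarith) fun i => by rw [ht i]; ring
  rcases le_or_gt t 1 with h₁ | h₁
  · exact hV.not_weighted_sum hc ha hb hb hac hbc hbc (x := 1 - t) (y := t) (z := 0)
      (by linarith) h₀ le_rfl (by linarith) fun i => by rw [ht i]; ring
  · exact hV.not_weighted_sum hb ha hc hc hab hbc.symm hbc.symm (x := t - 1) (y := 1) (z := 0)
      (by linarith) (by simp) le_rfl (by linarith) fun i => by rw [ht i]; ring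

theorem ConvexPos.isCyclicOn {V : Finset Pt} (hV : ConvexPos V) :
    IsCyclicOn V fun a b c => 0 < orient a b c where
  cyc {a b c} h := by rwa [orient_rotate]
  asymm {a b c} h := by rw [orient_swap]; linarith
  total {a b c} ha hb hc hab hbc hac := by
    rw [orient_swap a b c, neg_pos]
    exact (hV.orient_ne_zero ha hb hc hab hbc hac).lt_or_gt.symm
  trans {a b c d} ha hb hc hd h₁ h₂ := by
    by_contra! hn
    refine hV.not_weighted_sum ha hb hc hd (ne_of_orient_pos h₁).1.symm
      (ne_of_orient_pos h₂).1.symm (ne_of_orient_pos h₂).2.2.symm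
      h₂.le (neg_nonneg.2 hn) h₁.le (by linarith) fun i => ?_
    unfold orient
    fin_cases i <;> simp only [Fin.zero_eta, Fin.mk_one] <;> ring

theorem ConvexPos.cross {V : Finset Pt} (hV : ConvexPos V) {a b v w : Pt} (ha : a ∈ V)
    (hb : b ∈ V) (hv : v ∈ V) (hw : w ∈ V) (h₁ : 0 < orient a b v) (h₂ : 0 < orient b a w) :
    Cross s(a, b) s(v, w) := by
  have h := hV.isCyclicOn
  have h₃ : 0 < orient w v a := h.cyc (h.trans ha hw hb hv (h.cyc h₂) h₁)
  have h₄ : 0 < orient v w b :=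
    h.cyc (h.trans hb hv ha hw (h.cyc h₁) h₂)
  refine ⟨?_, ?_⟩
  · intro he
    have hav := (ne_of_orient_pos h₁).2.2
    have haw := (ne_of_orient_pos h₂).2.1
    have : a ∈ s(v, w) := he ▸ Sym2.mem_mk_left a b
    rcases Sym2.mem_iff.1 this with h | h
    exacts [hav h, haw h]
  · have hsum : orient v w b + orient w v a = orient b a w + orient a b v := by
      unfold orient
      ring
    have hpos : 0 < orient v w b + orient w v a := by linarith
    refine ⟨(orient v w b / (orient v w b + orient w v a)) • a +
      (orient w v a / (orient v w b + orient w v a)) • b,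
      ⟨_, _, div_pos h₄ hpos, div_pos h₃ hpos, by field_simp, rfl⟩,
      ⟨orient b a w / (orient v w b + orient w v a), orient a b v / (orient v w b + orient w v a),
        div_pos h₂ hpos, div_pos h₁ hpos, by rw [← add_div, ← hsum, div_self hpos.ne'], ?_⟩⟩
    ext i
    simp only [PiLp.add_apply, PiLp.smul_apply, smul_eq_mul]
    field_simp
    unfold orient
    fin_cases i <;> simp only [Fin.zero_eta, Fin.mk_one] <;> ring

/-- The graph obtained by deleting a vertex. -/
noncomputable def ConvexGeomGraph.deleteVertex (G : ConvexGeomGraph) (v : Pt) :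
    ConvexGeomGraph where
  V := G.V.erase v
  E := G.E.filter fun e => v ∉ e
  convexPos := G.convexPos.mono (Finset.erase_subset _ _)
  not_diag e he := G.not_diag e (Finset.mem_filter.1 he).1
  mem_V e he p hp := by
    rw [Finset.mem_filter] at he
    refine Finset.mem_erase.2 ⟨?_, G.mem_V e he.1 p hp⟩
    rintro rfl
    exact he.2 hp

theorem OuterKPlanar.deleteVertex {G : ConvexGeomGraph} {k : ℕ} (hG : OuterKPlanar G k) (v : Pt) :
    OuterKPlanar (G.deleteVertex v) k := fun e he =>
  (Finset.card_le_card (Finset.filter_subset_filter _ (Finset.filter_subset _ _))).trans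
    (hG e (Finset.mem_filter.1 he).1)

theorem ConvexGeomGraph.card_E_le (G : ConvexGeomGraph) (v : Pt) :
    G.E.card ≤ (G.deleteVertex v).E.card + (G.V.filter fun w => s(v, w) ∈ G.E).card := by
  have h₁ : (G.E.filter fun e => v ∈ e).card ≤ (G.V.filter fun w => s(v, w) ∈ G.E).card := by
    refine (Finset.card_le_card ?_).trans
      (Finset.card_image_le (f := fun w => s(v, w)))
    intro e he
    obtain ⟨he, w, rfl⟩ := Finset.mem_filter.1 he
    exact Finset.mem_image.2
      ⟨w, Finset.mem_filter.2 ⟨G.mem_V _ he w (Sym2.mem_mk_right v w), he⟩, rfl⟩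
  have h₂ := Finset.card_filter_add_card_filter_not (s := G.E) fun e => v ∈ e
  change _ ≤ (G.E.filter fun e => v ∉ e).card + _
  omega

theorem OuterKPlanar.card_crossing_le {G : ConvexGeomGraph} {k : ℕ} (hG : OuterKPlanar G k)
    {a b : Pt} (hab : s(a, b) ∈ G.E) :
    ((side G.V (fun a b c => 0 < orient a b c) a b ×ˢ
      side G.V (fun a b c => 0 < orient a b c) b a).filter
        fun p => s(p.1, p.2) ∈ G.E).card ≤ k := by
  refine le_trans ?_ (hG _ hab)
  have ha := G.mem_V _ hab a (Sym2.mem_mk_left a b)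
  have hb := G.mem_V _ hab b (Sym2.mem_mk_right a b)
  refine Finset.card_le_card_of_injOn (fun p => s(p.1, p.2)) ?_ ?_
  · rintro ⟨v, w⟩ hp
    simp only [side, Finset.coe_filter, Finset.mem_product, Finset.mem_filter,
      Set.mem_ofPred_eq] at hp ⊢
    exact ⟨hp.2, G.convexPos.cross ha hb hp.1.1.1 hp.1.2.1 hp.1.1.2 hp.1.2.2⟩
  · rintro ⟨v, w⟩ hp ⟨v', w'⟩ hp' heq
    simp only [Finset.coe_filter, Finset.mem_product, Set.mem_ofPred_eq] at hp hp'
    rcases Sym2.eq_iff.1 heq with ⟨rfl, rfl⟩ | ⟨rfl, rfl⟩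
    · rfl
    · exact absurd hp'.1.2
        (Finset.disjoint_left.1 (G.convexPos.isCyclicOn.disjoint_side a b) hp.1.1)

theorem OuterKPlanar.card_E_le {k d : ℕ} (hd : 4 ≤ d)
    (hkd : 4963984 * k < 1000000 * (d + 1) ^ 2) (A : Set Pt) (n : ℕ) :
    ∀ G : ConvexGeomGraph, OuterKPlanar G k →
      (∀ v w, s(v, w) ∈ G.E → (v ∈ A ↔ w ∉ A)) → G.V.card = n → G.E.card ≤ d * n := by
  induction n with
  | zero =>
    intro G _ _ hn
    rw [Finset.card_eq_zero] at hn
    have : G.E = ∅ := by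
      refine Finset.eq_empty_of_forall_notMem fun e he => ?_
      have := G.mem_V e he e.out.1 (Sym2.out_fst_mem e)
      simp [hn] at this
    simp [this]
  | succ n ih =>
    intro G hG hA hn
    obtain ⟨v, hv, hvd⟩ := G.convexPos.isCyclicOn.exists_card_adj_lt
      (Finset.card_pos.1 (by omega)) (adj := fun v w => s(v, w) ∈ G.E)
      (fun h => by rwa [Sym2.eq_swap]) A hA
      (fun a _ b _ hab => by convert hG.card_crossing_le hab) (δ := d + 1) (by omega) hkd
    have h₁ := ih (G.deleteVertex v) (hG.deleteVertex v)
      (fun x y hxy => hA x y (Finset.mem_filter.1 hxy).1)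
      (by change (G.V.erase v).card = n; rw [Finset.card_erase_of_mem hv]; omega)
    have h₂ := G.card_E_le v
    have h₃ : (G.V.filter fun w => s(v, w) ∈ G.E).card < d + 1 := by convert hvd
    rw [Nat.mul_succ]
    omega

/-- for every k ≥ 5, every bipartite outer k-planar graph on n
vertices has at most 2.228·√k·n edges. -/
theorem stmt13 (k : ℕ) (hk : 5 ≤ k) (G : ConvexGeomGraph)
    (hG : OuterKPlanar G k) (hbip : Bipartite G) :
    (G.E.card : ℝ) ≤ 2.228 * Real.sqrt k * G.V.card := by
  obtain ⟨A, B, -, hAB, hE⟩ := hbip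
  have hs : (2.236 : ℝ) ≤ Real.sqrt k := by
    refine Real.le_sqrt_of_sq_le ?_
    have : (5 : ℝ) ≤ k := by exact_mod_cast hk
    norm_num
    linarith
  have hfloor := Nat.lt_floor_add_one (2.228 * Real.sqrt k)
  have hkd : 4963984 * k < 1000000 * (⌊2.228 * Real.sqrt k⌋₊ + 1) ^ 2 := by
    have h₁ : (2.228 * Real.sqrt k) ^ 2 < ((⌊2.228 * Real.sqrt k⌋₊ : ℝ) + 1) ^ 2 :=
      pow_lt_pow_left₀ hfloor (by positivity) (by norm_num)
    rw [mul_pow, Real.sq_sqrt (by positivity)] at h₁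
    have h₂ : (4963984 * k : ℝ) < 1000000 * ((⌊2.228 * Real.sqrt k⌋₊ : ℝ) + 1) ^ 2 := by
      norm_num at h₁
      linarith
    exact_mod_cast h₂
  have hle := OuterKPlanar.card_E_le (d := ⌊2.228 * Real.sqrt k⌋₊)
    (Nat.le_floor (by norm_num; linarith)) hkd A G.V.card G hG
    (fun v w hvw => by
      obtain ⟨a, ha, b, hb, he⟩ := hE _ hvw
      have hb' := Finset.disjoint_right.1 hAB hb
      rcases Sym2.eq_iff.1 he with ⟨rfl, rfl⟩ | ⟨rfl, rfl⟩ <;> simp [ha, hb']) rfl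
  calc (G.E.card : ℝ) ≤ (⌊2.228 * Real.sqrt k⌋₊ : ℝ) * G.V.card := by exact_mod_cast hle
    _ ≤ 2.228 * Real.sqrt k * G.V.card := by
      gcongr
      exact Nat.floor_le (by positivity)
end

section
/- Let V be a set of n points in ℝ² in convex position, partitioned into sets A and B, and let E be a set of m edges (straight-line segments between pairs of points of V) each joining a point of A to a point of B, with m ≥ (15/4)·n. Then the number of unordered pairs of distinct edges of E that cross is at least (64/675)·m³/n². -/
open scoped Classical

/-- The interleaving pairs of edges, for edges written as pairs of naturals. -/
def interleaved (E : Finset (ℕ × ℕ)) : Finset ((ℕ × ℕ) × (ℕ × ℕ)) :=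
  (E ×ˢ E).filter fun p => p.1.1 < p.2.1 ∧ p.2.1 < p.1.2 ∧ p.1.2 < p.2.2

theorem mem_interleaved {E : Finset (ℕ × ℕ)} {p : (ℕ × ℕ) × (ℕ × ℕ)} :
    p ∈ interleaved E ↔
      p.1 ∈ E ∧ p.2 ∈ E ∧ p.1.1 < p.2.1 ∧ p.2.1 < p.1.2 ∧ p.1.2 < p.2.2 := by
  simp [interleaved, and_assoc]

/-- The edges spanned by the interval `[i, j]`. -/
def edgesIn (E : Finset (ℕ × ℕ)) (i j : ℕ) : Finset (ℕ × ℕ) :=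
  E.filter fun e => i ≤ e.1 ∧ e.2 ≤ j

theorem mem_edgesIn {E : Finset (ℕ × ℕ)} {i j : ℕ} {e : ℕ × ℕ} :
    e ∈ edgesIn E i j ↔ e ∈ E ∧ i ≤ e.1 ∧ e.2 ≤ j := by
  simp [edgesIn]

/-- The vertices in the interval `[i, j]`. -/
def vertsIn (V : Finset ℕ) (i j : ℕ) : Finset ℕ := V.filter fun x => i ≤ x ∧ x ≤ j

theorem mem_vertsIn {V : Finset ℕ} {i j x : ℕ} :
    x ∈ vertsIn V i j ↔ x ∈ V ∧ i ≤ x ∧ x ≤ j := by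
  simp [vertsIn]

theorem card_vertsIn_add {V : Finset ℕ} {a b c : ℕ} (hb : b ∈ V) (hab : a ≤ b) (hbc : b ≤ c) :
    (vertsIn V a b).card + (vertsIn V b c).card = (vertsIn V a c).card + 1 := by
  have hu : vertsIn V a b ∪ vertsIn V b c = vertsIn V a c := by
    ext x
    simp only [Finset.mem_union, mem_vertsIn]
    grind
  have hi : vertsIn V a b ∩ vertsIn V b c = {b} := by
    ext x
    simp only [Finset.mem_inter, mem_vertsIn, Finset.mem_singleton]
    grind
  rw [← Finset.card_union_add_card_inter, hu, hi, Finset.card_singleton]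

theorem interleaved_disjoint {E : Finset (ℕ × ℕ)} (a b c : ℕ) :
    Disjoint (interleaved (edgesIn E a b)) (interleaved (edgesIn E b c)) := by
  rw [Finset.disjoint_left]
  intro p hp hq
  simp only [mem_interleaved, mem_edgesIn] at hp hq
  omega

theorem interleaved_union_subset {E : Finset (ℕ × ℕ)} {a b c : ℕ} (hab : a ≤ b) (hbc : b ≤ c) :
    interleaved (edgesIn E a b) ∪ interleaved (edgesIn E b c) ⊆ interleaved (edgesIn E a c) := by
  intro p hp
  simp only [Finset.mem_union, mem_interleaved, mem_edgesIn] at hp ⊢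
  rcases hp with hp | hp
  · exact ⟨⟨hp.1.1, by omega, by omega⟩, ⟨hp.2.1.1, by omega, by omega⟩, hp.2.2⟩
  · exact ⟨⟨hp.1.1, by omega, by omega⟩, ⟨hp.2.1.1, by omega, by omega⟩, hp.2.2⟩

theorem card_interleaved_superadd (E : Finset (ℕ × ℕ)) {a b c : ℕ} (hab : a ≤ b) (hbc : b ≤ c) :
    (interleaved (edgesIn E a b)).card + (interleaved (edgesIn E b c)).card ≤
      (interleaved (edgesIn E a c)).card := by
  rw [← Finset.card_union_of_disjoint (interleaved_disjoint a b c)]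
  exact Finset.card_le_card (interleaved_union_subset hab hbc)

theorem card_interleaved_superadd_succ {E : Finset (ℕ × ℕ)} {a b c : ℕ} (hab : a ≤ b)
    (hbc : b ≤ c) {p : (ℕ × ℕ) × (ℕ × ℕ)} (hp : p ∈ interleaved (edgesIn E a c))
    (h1 : p.1.1 < b) (h2 : b < p.1.2) :
    (interleaved (edgesIn E a b)).card + (interleaved (edgesIn E b c)).card + 1 ≤
      (interleaved (edgesIn E a c)).card := by
  rw [← Finset.card_union_of_disjoint (interleaved_disjoint a b c),
    ← Finset.card_insert_of_notMem (a := p)]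
  · exact Finset.card_le_card (Finset.insert_subset hp (interleaved_union_subset hab hbc))
  · simp only [Finset.mem_union, mem_interleaved, mem_edgesIn]
    omega

/-- Interleaving of two edges, in either order. -/
def Interleave (e f : ℕ × ℕ) : Prop :=
  (e.1 < f.1 ∧ f.1 < e.2 ∧ e.2 < f.2) ∨ (f.1 < e.1 ∧ e.1 < f.2 ∧ f.2 < e.2)

theorem sparse_bound {V : Finset ℕ} {E : Finset (ℕ × ℕ)} {col : ℕ → Prop}
    (hE : ∀ e ∈ E, e.1 ∈ V ∧ e.2 ∈ V ∧ e.1 < e.2 ∧ ¬ (col e.1 ↔ col e.2))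
    (h1 : ∀ e ∈ E, ∀ f ∈ E, ∀ g ∈ E, Interleave e f → Interleave e g → f = g) :
    ∀ n i j, (vertsIn V i j).card = n → i ∈ V → j ∈ V → i < j →
      4 * (edgesIn E i j).card + (if (i, j) ∈ E then 10 else 12) ≤
        2 * (interleaved (edgesIn E i j)).card + 7 * (vertsIn V i j).card := by
  intro n
  induction n using Nat.strong_induction_on with
  | _ n ih =>
  intro i j hn hi hj hij
  have hend : ((edgesIn E i j).filter (· = (i, j))).card = if (i, j) ∈ E then 1 else 0 := by
    split_ifs with h
    · rw [Finset.card_eq_one]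
      refine ⟨(i, j), ?_⟩
      ext e
      simp only [Finset.mem_filter, mem_edgesIn, Finset.mem_singleton]
      grind
    · rw [Finset.card_eq_zero, Finset.filter_eq_empty_iff]
      simp only [mem_edgesIn]
      grind
  have hsplit := Finset.card_filter_add_card_filter_not (s := edgesIn E i j) (· = (i, j))
  have htwo : ∀ a b, a ∈ V → b ∈ V → a < b → 2 ≤ (vertsIn V a b).card := by
    intro a b ha hb hab
    rw [← Finset.card_pair hab.ne]
    apply Finset.card_le_card
    intro x
    simp only [Finset.mem_insert, Finset.mem_singleton, mem_vertsIn]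
    grind
  by_cases hk : (E.filter fun e => e.1 = i ∧ e.2 < j).Nonempty
  · obtain ⟨⟨i', k⟩, hkm, hkmax⟩ := Finset.exists_max_image _ (fun e : ℕ × ℕ => e.2) hk
    simp only [Finset.mem_filter, and_imp] at hkm hkmax
    obtain ⟨hikE, rfl, hkj⟩ := hkm
    obtain ⟨-, hkV, hik, hikcol⟩ := hE _ hikE
    simp only at hkV hik hikcol
    by_cases hc : ∃ f ∈ E, i' < f.1 ∧ f.1 < k ∧ k < f.2 ∧ f.2 ≤ j
    · obtain ⟨⟨u, v⟩, huvE, hiu, huk, hkv, hvj⟩ := hc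
      simp only at hiu huk hkv hvj
      obtain ⟨huV, hvV, -, huvcol⟩ := hE _ huvE
      simp only at huV hvV huvcol
      have c1 := card_vertsIn_add huV hiu.le (huk.le.trans hkj.le)
      have c2 := card_vertsIn_add hkV huk.le hkj.le
      have c3 := card_vertsIn_add hvV hkv.le hvj
      have t1 := htwo _ _ hi huV hiu
      have t2 := htwo _ _ huV hkV huk
      have t3 := htwo _ _ hkV hvV hkv
      have t4 : 1 ≤ (vertsIn V v j).card :=
        Finset.card_pos.2 ⟨j, mem_vertsIn.2 ⟨hj, hvj, le_rfl⟩⟩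
      have x1 := card_interleaved_superadd_succ (E := E) (p := ((i', k), (u, v))) hiu.le
        (huk.le.trans hkj.le) (by simp only [mem_interleaved, mem_edgesIn]; grind) hiu huk
      have x2 := card_interleaved_superadd E huk.le hkj.le
      have x3 := card_interleaved_superadd E hkv.le hvj
      have b1 := ih _ (by omega) i' u rfl hi huV hiu
      have b2 := ih _ (by omega) u k rfl huV hkV huk
      have b3 := ih _ (by omega) k v rfl hkV hvV hkv
      have hsub : (edgesIn E i' j).filter (¬ · = (i', j)) ⊆
          (edgesIn E i' u ∪ edgesIn E u k) ∪ (edgesIn E k v ∪ edgesIn E v j) ∪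
            {(i', k), (u, v)} := by
        rintro ⟨x, y⟩ he
        simp only [Finset.mem_filter, mem_edgesIn, Finset.mem_union, Finset.mem_insert,
          Finset.mem_singleton, Prod.mk.injEq] at he ⊢
        obtain ⟨⟨hxE, hx, hy⟩, hne⟩ := he
        have hxy := (hE _ hxE).2.2.1
        have p1 := h1 _ hikE _ huvE _ hxE
        have p2 := h1 _ huvE _ hikE _ hxE
        have p3 : x = i' → y ≤ k := fun h => hkmax _ hxE h (by simp only; omega)
        simp only [Interleave, Prod.mk.injEq] at p1 p2 hxy
        simp only [hxE, true_and]
        omega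
      have hcard := Finset.card_le_card hsub
      have u1 := Finset.card_union_le (edgesIn E i' u ∪ edgesIn E u k ∪
        (edgesIn E k v ∪ edgesIn E v j)) {(i', k), (u, v)}
      have u2 := Finset.card_union_le (edgesIn E i' u ∪ edgesIn E u k)
        (edgesIn E k v ∪ edgesIn E v j)
      have u3 := Finset.card_union_le (edgesIn E i' u) (edgesIn E u k)
      have u4 := Finset.card_union_le (edgesIn E k v) (edgesIn E v j)
      have u5 : ({(i', k), (u, v)} : Finset (ℕ × ℕ)).card ≤ 2 := Finset.card_le_two
      have s12 : 22 ≤ (if (i', u) ∈ E then 10 else 12) + if (u, k) ∈ E then 10 else 12 := by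
        have q1 := fun h => (hE (i', u) h).2.2.2
        have q2 := fun h => (hE (u, k) h).2.2.2
        simp only at q1 q2
        clear * - q1 q2 hikcol
        split_ifs <;> first | omega | tauto
      have s3 : 10 ≤ if (k, v) ∈ E then 10 else 12 := by split_ifs <;> omega
      rcases hvj.eq_or_lt with rfl | hvj
      · have e4 : edgesIn E v v = ∅ := by
          refine Finset.eq_empty_of_forall_notMem fun e he => ?_
          rw [mem_edgesIn] at he
          have := (hE e he.1).2.2.1
          omega
        have e4' : (edgesIn E v v).card = 0 := by rw [e4, Finset.card_empty]
        have t4' : (vertsIn V v v).card ≤ 1 := by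
          rw [Finset.card_le_one]
          simp only [mem_vertsIn]
          omega
        have s3' : (i', v) ∈ E → (if (k, v) ∈ E then 10 else 12) = 12 := by
          intro h
          have q0 := (hE (i', v) h).2.2.2
          have q3 := fun h => (hE (k, v) h).2.2.2
          simp only at q0 q3
          clear * - q0 q3 hikcol
          split_ifs <;> first | omega | tauto
        clear ih hE h1 hkmax hsub
        generalize (if (i', u) ∈ E then 10 else 12) = w1 at *
        generalize (if (u, k) ∈ E then 10 else 12) = w2 at *
        generalize (if (k, v) ∈ E then 10 else 12) = w3 at *
        by_cases d0 : (i', v) ∈ E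
        · have s4 := s3' d0
          rw [if_pos d0] at hend ⊢
          omega
        · rw [if_neg d0] at hend ⊢
          omega
      · have b4 := ih _ (by omega) v j rfl hvV hj hvj
        have s4 : 10 ≤ if (v, j) ∈ E then 10 else 12 := by split_ifs <;> omega
        clear ih hE h1 hkmax hsub
        generalize (if (i', u) ∈ E then 10 else 12) = w1 at *
        generalize (if (u, k) ∈ E then 10 else 12) = w2 at *
        generalize (if (k, v) ∈ E then 10 else 12) = w3 at *
        generalize (if (v, j) ∈ E then 10 else 12) = w4 at *
        split_ifs at hend ⊢ <;> omega
    · have c1 := card_vertsIn_add hkV hik.le hkj.le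
      have t1 := htwo _ _ hi hkV hik
      have t2 := htwo _ _ hkV hj hkj
      have x1 := card_interleaved_superadd E hik.le hkj.le
      have b1 := ih _ (by omega) i' k rfl hi hkV hik
      have b2 := ih _ (by omega) k j rfl hkV hj hkj
      have hsub : (edgesIn E i' j).filter (¬ · = (i', j)) ⊆ edgesIn E i' k ∪ edgesIn E k j := by
        rintro ⟨x, y⟩ he
        simp only [Finset.mem_filter, mem_edgesIn, Finset.mem_union, Prod.mk.injEq] at he ⊢
        obtain ⟨⟨hxE, hx, hy⟩, hne⟩ := he
        have p3 : x = i' → y ≤ k := fun h => hkmax _ hxE h (by simp only; omega)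
        have p4 : ¬ (i' < x ∧ x < k ∧ k < y ∧ y ≤ j) := fun h => hc ⟨_, hxE, h⟩
        simp only [hxE, true_and]
        omega
      have hcard := (Finset.card_le_card hsub).trans (Finset.card_union_le _ _)
      rw [if_pos hikE] at b1
      have s2 : (i', j) ∈ E → (if (k, j) ∈ E then 10 else 12) = 12 := by
        intro h
        have q0 := (hE (i', j) h).2.2.2
        have q1 := fun h => (hE (k, j) h).2.2.2
        simp only at q0 q1
        clear * - q0 q1 hikcol
        split_ifs <;> first | omega | tauto
      have s2' : 10 ≤ if (k, j) ∈ E then 10 else 12 := by split_ifs <;> omega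
      clear ih hE h1 hkmax hsub
      generalize (if (k, j) ∈ E then 10 else 12) = w at *
      by_cases d0 : (i', j) ∈ E
      · have s3 := s2 d0
        rw [if_pos d0] at hend ⊢
        omega
      · rw [if_neg d0] at hend ⊢
        omega
  · have hne : (V.filter fun x => i < x ∧ x ≤ j).Nonempty := ⟨j, by simp [hj, hij]⟩
    obtain ⟨k, hkm, hkmin⟩ := Finset.exists_min_image _ id hne
    simp only [Finset.mem_filter, and_imp, id] at hkm hkmin
    obtain ⟨hkV, hik, hkj⟩ := hkm
    have c1 := card_vertsIn_add hkV hik.le hkj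
    have t1 := htwo _ _ hi hkV hik
    have x1 := card_interleaved_superadd E hik.le hkj
    have hsub : (edgesIn E i j).filter (¬ · = (i, j)) ⊆ edgesIn E k j := by
      rintro ⟨x, y⟩ he
      simp only [Finset.mem_filter, mem_edgesIn, Prod.mk.injEq] at he ⊢
      obtain ⟨⟨hxE, hx, hy⟩, hne'⟩ := he
      obtain ⟨hxV, -, hxy, -⟩ := hE _ hxE
      simp only at hxV hxy
      have p1 : ¬ (x = i ∧ y < j) := fun h => hk ⟨_, Finset.mem_filter.2 ⟨hxE, h⟩⟩
      have p2 : i < x → k ≤ x := fun h => hkmin x hxV h (by omega)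
      simp only [hxE, true_and]
      omega
    have hcard := Finset.card_le_card hsub
    rcases hkj.eq_or_lt with rfl | hkj
    · have e4 : edgesIn E k k = ∅ := by
        refine Finset.eq_empty_of_forall_notMem fun e he => ?_
        rw [mem_edgesIn] at he
        have := (hE e he.1).2.2.1
        omega
      rw [e4, Finset.card_empty] at hcard
      split_ifs at hend ⊢ <;> omega
    · have b1 := ih _ (by omega) k j rfl hkV hj hkj
      split_ifs at hend b1 ⊢ <;> omega

theorem linear_bound_sparse {V : Finset ℕ} {E : Finset (ℕ × ℕ)} {col : ℕ → Prop}
    (hE : ∀ e ∈ E, e.1 ∈ V ∧ e.2 ∈ V ∧ e.1 < e.2 ∧ ¬ (col e.1 ↔ col e.2))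
    (h1 : ∀ e ∈ E, ∀ f ∈ E, ∀ g ∈ E, Interleave e f → Interleave e g → f = g) :
    4 * E.card ≤ 2 * (interleaved E).card + 7 * V.card := by
  rcases E.eq_empty_or_nonempty with rfl | ⟨e, he⟩
  · simp
  have hV : V.Nonempty := ⟨_, (hE e he).1⟩
  have hlt : V.min' hV < V.max' hV :=
    (V.min'_le _ (hE e he).1).trans_lt ((hE e he).2.2.1.trans_le (V.le_max' _ (hE e he).2.1))
  have key := sparse_bound hE h1 _ _ _ rfl (V.min'_mem hV) (V.max'_mem hV) hlt
  have h2 : edgesIn E (V.min' hV) (V.max' hV) = E :=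
    Finset.filter_true_of_mem fun f hf => ⟨V.min'_le _ (hE f hf).1, V.le_max' _ (hE f hf).2.1⟩
  have h3 : vertsIn V (V.min' hV) (V.max' hV) = V :=
    Finset.filter_true_of_mem fun x hx => ⟨V.min'_le _ hx, V.le_max' _ hx⟩
  rw [h2, h3] at key
  omega

theorem interleaved_erase_card {E : Finset (ℕ × ℕ)} {e f g : ℕ × ℕ} (he : e ∈ E) (hf : f ∈ E)
    (hg : g ∈ E) (hfg : f ≠ g) (hef : Interleave e f) (heg : Interleave e g) :
    (interleaved (E.erase e)).card + 2 ≤ (interleaved E).card := by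
  have pick : ∀ f ∈ E, Interleave e f → ∃ p ∈ interleaved E, p = (e, f) ∨ p = (f, e) := by
    rintro f hf (h | h)
    · exact ⟨(e, f), mem_interleaved.2 ⟨he, hf, h⟩, Or.inl rfl⟩
    · exact ⟨(f, e), mem_interleaved.2 ⟨hf, he, h⟩, Or.inr rfl⟩
  obtain ⟨p, hp, hpe⟩ := pick f hf hef
  obtain ⟨q, hq, hqe⟩ := pick g hg heg
  have hpq : p ≠ q := by
    rintro rfl
    grind
  have hd : Disjoint (interleaved (E.erase e)) {p, q} := by
    rw [Finset.disjoint_right]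
    simp only [Finset.mem_insert, Finset.mem_singleton, mem_interleaved, Finset.mem_erase]
    grind
  rw [← Finset.card_pair hpq, ← Finset.card_union_of_disjoint hd]
  apply Finset.card_le_card
  intro r
  simp only [Finset.mem_union, Finset.mem_insert, Finset.mem_singleton]
  rintro (hr | rfl | rfl)
  · simp only [mem_interleaved, Finset.mem_erase] at hr ⊢
    exact ⟨hr.1.2, hr.2.1.2, hr.2.2⟩
  · exact hp
  · exact hq

theorem linear_bound {V : Finset ℕ} {col : ℕ → Prop} (E : Finset (ℕ × ℕ))
    (hE : ∀ e ∈ E, e.1 ∈ V ∧ e.2 ∈ V ∧ e.1 < e.2 ∧ ¬ (col e.1 ↔ col e.2)) :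
    4 * E.card ≤ 2 * (interleaved E).card + 7 * V.card := by
  induction E using Finset.strongInduction with
  | H E ih =>
  by_cases h1 : ∀ e ∈ E, ∀ f ∈ E, ∀ g ∈ E, Interleave e f → Interleave e g → f = g
  · exact linear_bound_sparse hE h1
  · push Not at h1
    obtain ⟨e, he, f, hf, g, hg, hef, heg, hfg⟩ := h1
    have h2 := interleaved_erase_card he hf hg hfg hef heg
    have h3 := ih _ (Finset.erase_ssubset he) fun f hf => hE f (Finset.mem_of_mem_erase hf)
    have h4 := Finset.card_erase_add_one he
    omega

/-- The chance that a random subset containing each point independently with probability `p`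
includes a given set `T`. -/
theorem sum_weight_superset {V T : Finset ℕ} (hT : T ⊆ V) (p : ℝ) :
    ∑ S ∈ V.powerset, (if T ⊆ S then p ^ S.card * (1 - p) ^ (V \ S).card else 0) =
      p ^ T.card := by
  have key := Finset.prod_add (fun _ : ℕ => p) (fun x => if x ∈ T then 0 else 1 - p) V
  have hl : ∏ x ∈ V, (p + if x ∈ T then 0 else 1 - p) = p ^ T.card := by
    have : ∀ x ∈ V, (p + if x ∈ T then 0 else 1 - p) = if x ∈ T then p else 1 := by
      intro x _
      split_ifs <;> ring
    rw [Finset.prod_congr rfl this, Finset.prod_ite_mem, Finset.inter_eq_right.2 hT,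
      Finset.prod_const]
  rw [← hl, key]
  refine Finset.sum_congr rfl fun S hS => ?_
  rw [Finset.prod_const]
  split_ifs with h
  · congr 1
    rw [← Finset.prod_const]
    refine Finset.prod_congr rfl fun x hx => ?_
    rw [if_neg fun hxT => (Finset.mem_sdiff.1 hx).2 (h hxT)]
  · obtain ⟨x, hxT, hxS⟩ := Finset.not_subset.1 h
    rw [Finset.prod_eq_zero (i := x) (Finset.mem_sdiff.2 ⟨hT hxT, hxS⟩) (by simp [hxT]), mul_zero]

theorem sum_weight_card {ι : Type*} {V : Finset ℕ} (F : Finset ι) (T : ι → Finset ℕ) {k : ℕ}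
    (hT : ∀ f ∈ F, T f ⊆ V ∧ (T f).card = k) (p : ℝ) :
    ∑ S ∈ V.powerset, p ^ S.card * (1 - p) ^ (V \ S).card *
      ((F.filter fun f => T f ⊆ S).card : ℝ) = F.card * p ^ k := by
  have : ∀ S ∈ V.powerset, p ^ S.card * (1 - p) ^ (V \ S).card *
      ((F.filter fun f => T f ⊆ S).card : ℝ) =
      ∑ f ∈ F, if T f ⊆ S then p ^ S.card * (1 - p) ^ (V \ S).card else 0 := by
    intro S _
    rw [← Finset.sum_filter, Finset.sum_const, nsmul_eq_mul, mul_comm]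
  rw [Finset.sum_congr rfl this, Finset.sum_comm,
    Finset.sum_congr rfl fun f hf => (sum_weight_superset (hT f hf).1 p).trans
      (congrArg (p ^ ·) (hT f hf).2), Finset.sum_const, nsmul_eq_mul]

theorem sampled_bound {V : Finset ℕ} {col : ℕ → Prop} (E : Finset (ℕ × ℕ))
    (hE : ∀ e ∈ E, e.1 ∈ V ∧ e.2 ∈ V ∧ e.1 < e.2 ∧ ¬ (col e.1 ↔ col e.2))
    {p : ℝ} (hp0 : 0 ≤ p) (hp1 : p ≤ 1) :
    4 * (E.card * p ^ 2) ≤ 2 * ((interleaved E).card * p ^ 4) + 7 * (V.card * p ^ 1) := by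
  rw [← sum_weight_card (V := V) E (fun e => {e.1, e.2}) (k := 2) _ p,
    ← sum_weight_card (V := V) (interleaved E)
      (fun q => {q.1.1, q.2.1, q.1.2, q.2.2}) (k := 4) _ p,
    ← sum_weight_card (V := V) V (fun x => {x}) (k := 1) _ p,
    Finset.mul_sum, Finset.mul_sum, Finset.mul_sum, ← Finset.sum_add_distrib]
  · refine Finset.sum_le_sum fun S hS => ?_
    have h := linear_bound (V := S) (col := col) (E.filter fun e => {e.1, e.2} ⊆ S) (by
      intro e he
      simp only [Finset.mem_filter, Finset.insert_subset_iff, Finset.singleton_subset_iff] at he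
      exact ⟨he.2.1, he.2.2, (hE e he.1).2.2⟩)
    have h2 : interleaved (E.filter fun e => ({e.1, e.2} : Finset ℕ) ⊆ S) =
        (interleaved E).filter fun q => {q.1.1, q.2.1, q.1.2, q.2.2} ⊆ S := by
      ext q
      simp only [mem_interleaved, Finset.mem_filter, Finset.insert_subset_iff,
        Finset.singleton_subset_iff]
      tauto
    have h3 : (V.filter fun x => {x} ⊆ S) = S := by
      ext x
      simp only [Finset.mem_filter, Finset.singleton_subset_iff, and_iff_right_iff_imp]
      exact fun hx => Finset.mem_powerset.1 hS hx
    rw [h2] at h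
    rw [h3]
    have hw : 0 ≤ p ^ S.card * (1 - p) ^ (V \ S).card :=
      mul_nonneg (pow_nonneg hp0 _) (pow_nonneg (by linarith) _)
    have h' := mul_le_mul_of_nonneg_left (Nat.cast_le (α := ℝ).2 h) hw
    push_cast at h'
    linarith
  · intro x hx
    simpa using hx
  · intro q hq
    rw [mem_interleaved] at hq
    have h1 := hE _ hq.1
    have h2 := hE _ hq.2.1
    refine ⟨by simp [Finset.insert_subset_iff, h1, h2], ?_⟩
    rw [Finset.card_insert_of_notMem, Finset.card_insert_of_notMem, Finset.card_pair] <;>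
      (try simp only [Finset.mem_insert, Finset.mem_singleton]) <;> omega
  · intro e he
    have h1 := hE _ he
    exact ⟨by simp [Finset.insert_subset_iff, h1], Finset.card_pair h1.2.2.1.ne⟩

theorem interleaved_lower_bound {V : Finset ℕ} {col : ℕ → Prop} (E : Finset (ℕ × ℕ))
    (hE : ∀ e ∈ E, e.1 ∈ V ∧ e.2 ∈ V ∧ e.1 < e.2 ∧ ¬ (col e.1 ↔ col e.2))
    (h : (15 / 4 : ℝ) * V.card ≤ E.card) :
    (64 / 675 : ℝ) * (E.card : ℝ) ^ 3 / (V.card : ℝ) ^ 2 ≤ ((interleaved E).card : ℝ) := by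
  rcases V.card.eq_zero_or_pos with h0 | h0
  · simp [h0]
  have hn : (0 : ℝ) < V.card := Nat.cast_pos.2 h0
  have hm : (0 : ℝ) < E.card := by linarith
  have hx : (0 : ℝ) ≤ (interleaved E).card := Nat.cast_nonneg _
  have key := sampled_bound E hE (p := 21 / 8 * V.card / E.card) (by positivity)
    (by rw [div_le_one hm]; linarith)
  generalize (V.card : ℝ) = n at *
  generalize (E.card : ℝ) = m at *
  generalize ((interleaved E).card : ℝ) = x at *
  rw [div_le_iff₀ (by positivity)]
  have k2 : 4 * (21 / 8) ^ 2 * m ^ 3 ≤ 2 * (21 / 8) ^ 4 * (x * n ^ 2) + 7 * (21 / 8) * m ^ 3 := by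
    have e1 : 4 * (m * (21 / 8 * n / m) ^ 2) = n ^ 2 / m ^ 4 * (4 * (21 / 8) ^ 2 * m ^ 3) := by
      field_simp
    have e2 : 2 * (x * (21 / 8 * n / m) ^ 4) + 7 * (n * (21 / 8 * n / m) ^ 1) =
        n ^ 2 / m ^ 4 * (2 * (21 / 8) ^ 4 * (x * n ^ 2) + 7 * (21 / 8) * m ^ 3) := by
      field_simp
    rw [e1, e2] at key
    exact le_of_mul_le_mul_left key (by positivity)
  have : 0 < m ^ 3 := by positivity
  linarith

theorem ConvexPos.not_combination {V : Finset Pt} (hV : ConvexPos V) {b x y z : Pt}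
    (hb : b ∈ V) (hx : x ∈ V) (hy : y ∈ V) (hz : z ∈ V) (hxb : x ≠ b) (hyb : y ≠ b) (hzb : z ≠ b)
    {r s t : ℝ} (hr : 0 ≤ r) (hs : 0 ≤ s) (ht : 0 ≤ t) (hpos : 0 < r + s + t)
    (h : ∀ i, (r + s + t) * b i = r * x i + s * y i + t * z i) : False := by
  apply hV b hb
  have hc := convex_convexHull ℝ ((V.erase b : Finset Pt) : Set Pt)
  have hm : ∀ w ∈ V, w ≠ b → w ∈ convexHull ℝ ((V.erase b : Finset Pt) : Set Pt) :=
    fun w hw hwb => subset_convexHull ℝ _ (Finset.mem_coe.2 (Finset.mem_erase.2 ⟨hwb, hw⟩))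
  have hmem := hc.sum_mem (t := Finset.univ) (w := ![r / (r + s + t), s / (r + s + t),
    t / (r + s + t)]) (z := ![x, y, z])
    (by intro i _; fin_cases i <;> simp <;> positivity)
    (by simp [Fin.sum_univ_three]; field_simp)
    (by intro i _; fin_cases i; exacts [hm x hx hxb, hm y hy hyb, hm z hz hzb])
  convert hmem using 1
  ext i
  simp only [Fin.sum_univ_three, Matrix.cons_val_zero, Matrix.cons_val_one, Matrix.cons_val,
    PiLp.add_apply, PiLp.smul_apply, smul_eq_mul]
  have := h i
  field_simp
  linarith

/-- In convex position, `b` cannot lie in a triangle `p a c`. -/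
theorem ConvexPos.orient_pos {V : Finset Pt} (hV : ConvexPos V) {p a b c : Pt} (hp : p ∈ V)
    (ha : a ∈ V) (hb : b ∈ V) (hc : c ∈ V) (hpb : p ≠ b) (hab : a ≠ b) (hcb : c ≠ b)
    (h1 : 0 < orient p a b) (h2 : 0 < orient p b c) (h3 : 0 < orient p a c) :
    0 < orient a b c := by
  by_contra! hcon
  have hsum : -orient a b c + orient p b c + orient p a b = orient p a c := by
    unfold orient; ring
  refine hV.not_combination hb hp ha hc hpb hab hcb (r := -orient a b c) (s := orient p b c)
    (t := orient p a b) (by linarith) h2.le h1.le (hsum ▸ h3) fun i => ?_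
  fin_cases i <;> simp [orient] <;> ring

theorem openSegment_inter_nonempty {a b c d : Pt} (habc : 0 < orient a b c)
    (hacd : 0 < orient a c d) (habd : 0 < orient a b d) (hbcd : 0 < orient b c d) :
    (openSegment ℝ a c ∩ openSegment ℝ b d).Nonempty := by
  have hD : orient a b c + orient a c d = orient a b d + orient b c d := by
    unfold orient; ring
  have hpos : 0 < orient a b c + orient a c d := by positivity
  refine ⟨(orient b c d / (orient a b c + orient a c d)) • a +
    (orient a b d / (orient a b c + orient a c d)) • c,
    ⟨_, _, by positivity, by positivity, by field_simp; linarith, rfl⟩,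
    orient a c d / (orient a b c + orient a c d), orient a b c / (orient a b c + orient a c d),
    by positivity, by positivity, by field_simp; ring, ?_⟩
  have hne := hpos.ne'
  ext i
  simp only [PiLp.add_apply, PiLp.smul_apply, smul_eq_mul]
  field_simp
  fin_cases i <;> simp [orient] <;> ring

/-- A lexicographic comparison of points, by first and then second coordinate. -/
def LexLT (p q : Pt) : Prop := p 0 < q 0 ∨ (p 0 = q 0 ∧ p 1 < q 1)

theorem exists_lexMin {V : Finset Pt} (hne : V.Nonempty) :
    ∃ p ∈ V, ∀ q ∈ V, q ≠ p → LexLT p q := by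
  obtain ⟨p, hp, hmin⟩ := Finset.exists_min_image V
    (fun q : Pt => (toLex (q 0, q 1) : Lex (ℝ × ℝ))) hne
  refine ⟨p, hp, fun q hq hqp => ?_⟩
  rcases (Prod.Lex.le_iff.1 (hmin q hq)) with h | ⟨h1, h2⟩
  · exact Or.inl h
  · refine Or.inr ⟨h1, lt_of_le_of_ne h2 fun h3 => hqp ?_⟩
    ext i
    fin_cases i
    · exact h1.symm
    · exact h3.symm

theorem orient_trans {p u v w : Pt} (hu : LexLT p u) (hv : LexLT p v) (hw : LexLT p w)
    (huv : 0 < orient p u v) (hvw : 0 < orient p v w) : 0 < orient p u w := by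
  unfold orient LexLT at *
  have hw0 : 0 ≤ w 0 - p 0 := by rcases hw with h | h <;> linarith [h]
  have hv0 : 0 < v 0 - p 0 := by
    rcases hv with h | h
    · linarith
    · rw [← h.1] at hvw
      nlinarith [mul_nonneg (sub_nonneg.2 h.2.le) hw0]
  have hu0 : 0 < u 0 - p 0 := by
    rcases hu with h | h
    · linarith
    · rw [← h.1] at huv
      nlinarith [mul_nonneg (sub_nonneg.2 h.2.le) hv0.le]
  have := mul_pos hu0 hvw
  have := mul_nonneg hw0 huv.le
  refine pos_of_mul_pos_right (a := v 0 - p 0) ?_ hv0.le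
  nlinarith

theorem ConvexPos.orient_ne_zero_s15 {V : Finset Pt} (hV : ConvexPos V) {p u v : Pt} (hp : p ∈ V)
    (hu : u ∈ V) (hv : v ∈ V) (huv : u ≠ v) (hpu : LexLT p u) (hpv : LexLT p v) :
    orient p u v ≠ 0 := by
  intro h0
  have hup : p ≠ u := by rintro rfl; simp [LexLT] at hpu
  have hvp : p ≠ v := by rintro rfl; simp [LexLT] at hpv
  have aux : ∃ r s : ℝ, 0 < r ∧ 0 < s ∧ ∀ i, r * (u i - p i) = s * (v i - p i) := by
    unfold LexLT orient at *
    by_cases hx : u 0 - p 0 = 0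
    · have hu1 : 0 < u 1 - p 1 := by
        rcases hpu with h | h <;> linarith [h]
      have hv0 : v 0 - p 0 = 0 := by
        rw [hx] at h0
        have : (u 1 - p 1) * (v 0 - p 0) = 0 := by linarith
        exact (mul_eq_zero.1 this).resolve_left hu1.ne'
      have hv1 : 0 < v 1 - p 1 := by
        rcases hpv with h | h <;> linarith [h]
      refine ⟨v 1 - p 1, u 1 - p 1, hv1, hu1, fun i => ?_⟩
      fin_cases i
      · simp [hx, hv0]
      · simp only [Fin.mk_one]; ring
    · have hu0 : 0 < u 0 - p 0 := by
        rcases hpu with h | h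
        · linarith
        · exact absurd (by linarith [h.1]) hx
      have hv0 : 0 < v 0 - p 0 := by
        rcases hpv with h | h
        · linarith
        · rw [← h.1, sub_self, mul_zero, sub_zero] at h0
          nlinarith [mul_pos hu0 (sub_pos.2 h.2)]
      refine ⟨v 0 - p 0, u 0 - p 0, hv0, hu0, fun i => ?_⟩
      fin_cases i
      · simp only [Fin.zero_eta]; ring
      · simp only [Fin.mk_one]; linarith
  obtain ⟨r, s, hr, hs, h⟩ := aux
  rcases le_total r s with hrs | hrs
  · refine hV.not_combination hv hp hu hu hvp huv huv (r := s - r) (s := r) (t := 0)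
      (by linarith) hr.le le_rfl (by linarith) fun i => ?_
    linarith [h i]
  · refine hV.not_combination hu hp hv hv hup huv.symm huv.symm (r := r - s) (s := s) (t := 0)
      (by linarith) hs.le le_rfl (by linarith) fun i => ?_
    linarith [h i]

/-- Points in convex position can be numbered counterclockwise. -/
theorem ConvexPos.exists_ccw_numbering {V : Finset Pt} (hV : ConvexPos V) :
    ∃ κ : Pt → ℕ, Set.InjOn κ V ∧ ∀ a ∈ V, ∀ b ∈ V, ∀ c ∈ V, κ a < κ b → κ b < κ c →
      0 < orient a b c := by
  rcases V.eq_empty_or_nonempty with rfl | hne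
  · exact ⟨fun _ => 0, by simp, by simp⟩
  obtain ⟨p, hp, hlex⟩ := exists_lexMin hne
  let R : Pt → Pt → Prop := fun a b => b ≠ p ∧ (a = p ∨ 0 < orient p a b)
  have hirr : ∀ a, ¬ R a a := by
    rintro a ⟨h1, h2 | h2⟩
    · exact h1 h2
    · have : orient p a a = 0 := by unfold orient; ring
      linarith
  have htrans : ∀ a ∈ V, ∀ b ∈ V, ∀ c ∈ V, R a b → R b c → R a c := by
    rintro a ha b hb c hc ⟨hb1, h1⟩ ⟨hc1, h2⟩
    refine ⟨hc1, ?_⟩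
    by_cases hap : a = p
    · exact Or.inl hap
    · exact Or.inr (orient_trans (hlex a ha hap) (hlex b hb hb1) (hlex c hc hc1)
        (h1.resolve_left hap) (h2.resolve_left hb1))
  have htot : ∀ a ∈ V, ∀ b ∈ V, a ≠ b → R a b ∨ R b a := by
    intro a ha b hb hab
    by_cases hap : a = p
    · exact Or.inl ⟨fun h => hab (hap.trans h.symm), Or.inl hap⟩
    by_cases hbp : b = p
    · exact Or.inr ⟨hap, Or.inl hbp⟩
    have hanti : orient p b a = -orient p a b := by unfold orient; ring
    rcases (hV.orient_ne_zero_s15 hp ha hb hab (hlex a ha hap) (hlex b hb hbp)).lt_or_gt with h | h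
    · exact Or.inr ⟨hap, Or.inr (by linarith)⟩
    · exact Or.inl ⟨hbp, Or.inr h⟩
  let κ : Pt → ℕ := fun a => (V.filter fun q => R q a).card
  have hmono : ∀ a ∈ V, ∀ b ∈ V, R a b → κ a < κ b := by
    intro a ha b hb hab
    refine Finset.card_lt_card (Finset.ssubset_iff_of_subset ?_ |>.2 ⟨a, ?_, ?_⟩)
    · intro q hq
      rw [Finset.mem_filter] at hq ⊢
      exact ⟨hq.1, htrans q hq.1 a ha b hb hq.2 hab⟩
    · exact Finset.mem_filter.2 ⟨ha, hab⟩
    · exact fun h => hirr a (Finset.mem_filter.1 h).2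
  have hrev : ∀ a ∈ V, ∀ b ∈ V, κ a < κ b → R a b := by
    intro a ha b hb hab
    have hne : a ≠ b := by rintro rfl; exact hab.ne rfl
    exact (htot a ha b hb hne).resolve_right fun h => (hmono b hb a ha h).not_gt hab
  refine ⟨κ, ?_, ?_⟩
  · intro a ha b hb hab
    by_contra hne
    rcases htot a ha b hb hne with h | h
    · exact (hmono a ha b hb h).ne hab
    · exact (hmono b hb a ha h).ne hab.symm
  · intro a ha b hb c hc hab hbc
    have h1 := hrev a ha b hb hab
    have h2 := hrev b hb c hc hbc
    have h3 := hrev a ha c hc (hab.trans hbc)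
    have hbc' := h2.2.resolve_left h1.1
    by_cases hap : a = p
    · rwa [hap]
    · refine hV.orient_pos hp ha hb hc h1.1.symm ?_ ?_ (h1.2.resolve_left hap) hbc'
        (h3.2.resolve_left hap)
      · rintro rfl; exact hirr _ h1
      · rintro rfl; exact hirr _ h2

/-- The edges of `E`, written as increasing pairs of labels in `W`, where `q x` is the point
labelled `x`. -/
noncomputable def labelledEdges (W : Finset ℕ) (q : ℕ → Pt) (E : Finset (Sym2 Pt)) :
    Finset (ℕ × ℕ) :=
  (W ×ˢ W).filter fun e => e.1 < e.2 ∧ s(q e.1, q e.2) ∈ E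

theorem mem_labelledEdges {W : Finset ℕ} {q : ℕ → Pt} {E : Finset (Sym2 Pt)} {e : ℕ × ℕ} :
    e ∈ labelledEdges W q E ↔ (e.1 ∈ W ∧ e.2 ∈ W) ∧ e.1 < e.2 ∧ s(q e.1, q e.2) ∈ E := by
  simp only [labelledEdges, Finset.mem_filter, Finset.mem_product]

theorem labelledEdges_injOn {W : Finset ℕ} {q : ℕ → Pt} (hq : Set.InjOn q W)
    (E : Finset (Sym2 Pt)) :
    Set.InjOn (fun e : ℕ × ℕ => s(q e.1, q e.2)) (labelledEdges W q E) := by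
  intro e he f hf hef
  obtain ⟨⟨h1, h2⟩, h3, -⟩ := mem_labelledEdges.1 he
  obtain ⟨⟨h4, h5⟩, h6, -⟩ := mem_labelledEdges.1 hf
  rcases Sym2.eq_iff.1 hef with ⟨h7, h8⟩ | ⟨h7, h8⟩
  · exact Prod.ext (hq h1 h4 h7) (hq h2 h5 h8)
  · have := hq h1 h5 h7
    have := hq h2 h4 h8
    omega

theorem card_interleaved_le_crossingNumber {W : Finset ℕ} {q : ℕ → Pt} (hq : Set.InjOn q W)
    (hor : ∀ x ∈ W, ∀ y ∈ W, ∀ z ∈ W, x < y → y < z → 0 < orient (q x) (q y) (q z))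
    (E : Finset (Sym2 Pt)) :
    (interleaved (labelledEdges W q E)).card ≤ crossingNumber E := by
  have hinj := labelledEdges_injOn hq E
  refine Finset.card_le_card_of_injOn
    (fun r => s(s(q r.1.1, q r.1.2), s(q r.2.1, q r.2.2))) ?_ ?_
  · intro r hr
    obtain ⟨h1, h2, h3, h4, h5⟩ := mem_interleaved.1 hr
    obtain ⟨⟨ha, hc⟩, -, he⟩ := mem_labelledEdges.1 h1
    obtain ⟨⟨hb, hd⟩, -, hf⟩ := mem_labelledEdges.1 h2
    simp only [Finset.coe_filter, Set.mem_ofPred_eq, Finset.mk_mem_sym2_iff, Sym2.lift_mk]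
    refine ⟨⟨he, hf⟩, fun heq => ?_, ?_⟩
    · rw [hinj h1 h2 heq] at h3
      exact lt_irrefl _ h3
    · exact openSegment_inter_nonempty (hor _ ha _ hb _ hc h3 h4)
        (hor _ ha _ hc _ hd (h3.trans h4) h5) (hor _ ha _ hb _ hd h3 (h4.trans h5))
        (hor _ hb _ hc _ hd h4 h5)
  · intro r hr t ht hrt
    obtain ⟨h1, h2, h3, -, -⟩ := mem_interleaved.1 hr
    obtain ⟨h4, h5, h6, -, -⟩ := mem_interleaved.1 ht
    rcases Sym2.eq_iff.1 hrt with ⟨h7, h8⟩ | ⟨h7, h8⟩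
    · exact Prod.ext (hinj h1 h4 h7) (hinj h2 h5 h8)
    · rw [hinj h1 h5 h7, hinj h2 h4 h8] at h3
      exact absurd h3 h6.not_gt

theorem card_le_card_labelledEdges {W : Finset ℕ} {q : ℕ → Pt} {E : Finset (Sym2 Pt)}
    (hE : ∀ e ∈ E, ∃ x ∈ W, ∃ y ∈ W, x ≠ y ∧ e = s(q x, q y)) :
    E.card ≤ (labelledEdges W q E).card := by
  refine Finset.card_le_card_of_surjOn (fun e => s(q e.1, q e.2)) fun e he => ?_
  obtain ⟨x, hx, y, hy, hxy, rfl⟩ := hE e he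
  rcases hxy.lt_or_gt with hlt | hlt
  · exact ⟨(x, y), mem_labelledEdges.2 ⟨⟨hx, hy⟩, hlt, he⟩, rfl⟩
  · exact ⟨(y, x), mem_labelledEdges.2 ⟨⟨hy, hx⟩, hlt, by rwa [Sym2.eq_swap]⟩, Sym2.eq_swap⟩

/-- bipartite convex crossing lemma. -/
theorem stmt15 (V A B : Finset Pt) (E : Finset (Sym2 Pt)) (hV : ConvexPos V)
    (hAB : A ∪ B = V) (hdisj : Disjoint A B)
    (hbip : ∀ e ∈ E, ∃ a ∈ A, ∃ b ∈ B, e = s(a, b))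
    (h : (15 / 4 : ℝ) * V.card ≤ E.card) :
    (64 / 675 : ℝ) * (E.card : ℝ) ^ 3 / (V.card : ℝ) ^ 2 ≤ (crossingNumber E : ℝ) := by
  obtain ⟨κ, hinj, hκ⟩ := hV.exists_ccw_numbering
  have hA : ∀ a ∈ A, a ∈ V := fun a ha => hAB ▸ Finset.mem_union_left _ ha
  have hB : ∀ b ∈ B, b ∈ V := fun b hb => hAB ▸ Finset.mem_union_right _ hb
  obtain ⟨q, hq⟩ : ∃ q : ℕ → Pt, ∀ a ∈ V, q (κ a) = a :=
    ⟨Function.invFunOn κ V, fun a ha => hinj.leftInvOn_invFunOn ha⟩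
  obtain ⟨W, hW⟩ : ∃ W, W = V.image κ := ⟨_, rfl⟩
  have hqW : ∀ x ∈ W, q x ∈ V ∧ κ (q x) = x := by
    intro x hx
    rw [hW] at hx
    obtain ⟨a, ha, rfl⟩ := Finset.mem_image.1 hx
    rw [hq a ha]
    exact ⟨ha, rfl⟩
  have hκW : ∀ a ∈ V, κ a ∈ W := fun a ha => hW ▸ Finset.mem_image_of_mem _ ha
  have hWcard : W.card = V.card := hW ▸ Finset.card_image_of_injOn hinj
  have hqinj : Set.InjOn q W := by
    intro x hx y hy hxy
    rw [← (hqW x hx).2, ← (hqW y hy).2, hxy]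
  have hbi : ∀ e ∈ labelledEdges W q E,
      e.1 ∈ W ∧ e.2 ∈ W ∧ e.1 < e.2 ∧ ¬ (q e.1 ∈ A ↔ q e.2 ∈ A) := by
    intro e he
    obtain ⟨⟨h1, h2⟩, h3, h4⟩ := mem_labelledEdges.1 he
    refine ⟨h1, h2, h3, ?_⟩
    obtain ⟨a, ha, b, hb, hab⟩ := hbip _ h4
    have hbA : b ∉ A := fun hbA => Finset.disjoint_left.1 hdisj hbA hb
    rcases Sym2.eq_iff.1 hab with ⟨h5, h6⟩ | ⟨h5, h6⟩ <;> rw [h5, h6] <;> tauto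
  have hcard : E.card ≤ (labelledEdges W q E).card := by
    refine card_le_card_labelledEdges fun e he => ?_
    obtain ⟨a, ha, b, hb, rfl⟩ := hbip e he
    refine ⟨κ a, hκW a (hA a ha), κ b, hκW b (hB b hb), fun hab => ?_, ?_⟩
    · exact Finset.disjoint_left.1 hdisj ha (hinj (hA a ha) (hB b hb) hab ▸ hb)
    · rw [hq a (hA a ha), hq b (hB b hb)]
  have hcross := card_interleaved_le_crossingNumber hqinj (by
    intro x hx y hy z hz hxy hyz
    refine hκ _ (hqW x hx).1 _ (hqW y hy).1 _ (hqW z hz).1 ?_ ?_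
    · rwa [(hqW x hx).2, (hqW y hy).2]
    · rwa [(hqW y hy).2, (hqW z hz).2]) E
  have key := interleaved_lower_bound (V := W) (col := fun x => q x ∈ A) _ hbi (by
    rw [hWcard]
    exact h.trans (Nat.cast_le.2 hcard))
  rw [hWcard] at key
  refine le_trans ?_ (key.trans (Nat.cast_le.2 hcross))
  gcongr
end
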